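/- arXiv:1905.03568 — 3 statements merged into one kernel-verified Lean document; each statement's English description precedes it below -/
import Mathlib

section
/- Let 1 ≤ d < N be integers, A ∈ ℝ^{d×(N−d)}, α₀ ∈ ℝ^{N−d}, and let Ã ∈ ℝ^{(d+1)×(N−d)} be the matrix with first row α₀ and remaining rows those of A. If ω_m(A) = Nd and ω'_m(A, Nd) < 1 − 2d, then the submanifold ℋ := {(x, x̃Ã) : x ∈ [0,1]^d} ⊂ ℝ^N is of strong Khintchine type for convergence: for every (not necessarily non-increasing) ψ : [1,∞) → (0,1] with Σ_{q=1}^∞ ψ(q)^N < ∞, the d-dimensional Hausdorff measure of 𝒮_N(ψ) ∩ ℋ is 0. -/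
open scoped BigOperators

/-- distance from a real number to the nearest integer -/
noncomputable def distNearestInt (x : ℝ) : ℝ := |x - (round x : ℤ)|

/-- the sup norm `|q|_∞` of an integer vector, as a real number -/
noncomputable def intSupNorm {k : ℕ} (q : Fin k → ℤ) : ℝ := ‖(fun j => (q j : ℝ))‖

/-- the multiplicative exponent `ω_m(L)` of a matrix `L` (with `sup ∅ = -∞`, via `EReal`) -/
noncomputable def multExp {M N : ℕ} (L : Matrix (Fin M) (Fin N) ℝ) : EReal :=
  sSup ((fun γ : ℝ => (γ : EReal)) '' {γ : ℝ |
    {q : Fin N → ℤ | q ≠ 0 ∧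
      (∏ i, distNearestInt (∑ j, L i j * (q j : ℝ))) ≤ intSupNorm q ^ (-γ)}.Infinite})

/-- the multiplicative logarithmic exponent `ω'_m(L, ω₀)` of a matrix `L` at `ω₀` -/
noncomputable def multLogExp {M N : ℕ} (L : Matrix (Fin M) (Fin N) ℝ) (ω₀ : ℝ) : EReal :=
  sSup ((fun γ : ℝ => (γ : EReal)) '' {γ : ℝ |
    {q : Fin N → ℤ | ¬ (∀ j, |q j| ≤ 1) ∧
      (∏ i, distNearestInt (∑ j, L i j * (q j : ℝ))) ≤
        intSupNorm q ^ (-ω₀) * Real.log (intSupNorm q) ^ (-γ)}.Infinite})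

/-- the set `𝒮_N(ψ)` of simultaneously `ψ`-approximable points in `ℝ^N` -/
def simultApprox (N : ℕ) (ψ : ℝ → ℝ) : Set (EuclideanSpace ℝ (Fin N)) :=
  {z | {q : ℕ | 0 < q ∧ ∀ i, distNearestInt ((q : ℝ) * z i) < ψ q}.Infinite}

theorem distNearestInt_nonneg (x : ℝ) : 0 ≤ distNearestInt x := abs_nonneg _

theorem distNearestInt_le_half (x : ℝ) : distNearestInt x ≤ 1 / 2 := abs_sub_round x

theorem distNearestInt_le_abs_sub_intCast (x : ℝ) (m : ℤ) : distNearestInt x ≤ |x - m| :=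
  round_le x m

theorem distNearestInt_le_add_abs_sub (x y : ℝ) :
    distNearestInt x ≤ distNearestInt y + |x - y| := by
  calc distNearestInt x ≤ |x - (round y : ℤ)| := distNearestInt_le_abs_sub_intCast _ _
    _ = |(y - (round y : ℤ)) + (x - y)| := by congr 1; ring
    _ ≤ _ := abs_add_le _ _

/-- The additive character `x ↦ exp (2πix)` of `ℝ / ℤ`. -/
noncomputable def expChar (x : ℝ) : ℂ := Complex.exp (Complex.I * ((2 * Real.pi * x : ℝ) : ℂ))

theorem expChar_add (x y : ℝ) : expChar (x + y) = expChar x * expChar y := by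
  rw [expChar, expChar, expChar, ← Complex.exp_add]
  congr 1
  push_cast
  ring

theorem expChar_zero : expChar 0 = 1 := by simp [expChar]

theorem expChar_sum {ι : Type*} (s : Finset ι) (f : ι → ℝ) :
    expChar (∑ i ∈ s, f i) = ∏ i ∈ s, expChar (f i) := by
  classical
  induction s using Finset.induction_on with
  | empty => simp [expChar_zero]
  | insert a s ha ih => rw [Finset.sum_insert ha, Finset.prod_insert ha, expChar_add, ih]

theorem expChar_natCast_mul (m : ℕ) (x : ℝ) : expChar (m * x) = expChar x ^ m := by
  rw [expChar, expChar, ← Complex.exp_nat_mul]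
  congr 1
  push_cast
  ring

theorem norm_expChar (x : ℝ) : ‖expChar x‖ = 1 := by
  rw [expChar, mul_comm]
  exact Complex.norm_exp_ofReal_mul_I _

theorem conj_expChar (x : ℝ) : (starRingEnd ℂ) (expChar x) = expChar (-x) := by
  rw [expChar, expChar, ← Complex.exp_conj, map_mul, Complex.conj_I, Complex.conj_ofReal]
  congr 1
  push_cast
  ring

theorem expChar_intCast (m : ℤ) : expChar m = 1 := by
  rw [expChar, Complex.exp_eq_one_iff]
  exact ⟨m, by push_cast; ring⟩

theorem expChar_sub_intCast (x : ℝ) (m : ℤ) : expChar (x - m) = expChar x := by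
  have h := expChar_add (x - m) m
  rw [sub_add_cancel, expChar_intCast, mul_one] at h
  exact h.symm

theorem re_expChar (x : ℝ) : (expChar x).re = Real.cos (2 * Real.pi * x) := by
  rw [expChar, mul_comm, Complex.exp_ofReal_mul_I_re]

theorem distNearestInt_le_norm_expChar_sub_one (x : ℝ) :
    4 * distNearestInt x ≤ ‖expChar x - 1‖ := by
  rw [← expChar_sub_intCast x (round x), expChar, Complex.norm_exp_I_mul_ofReal_sub_one]
  have hx := abs_sub_round x
  have hpi := Real.pi_pos
  have h := @Real.mul_abs_le_abs_sin (2 * Real.pi * (x - round x) / 2) (by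
    rw [show 2 * Real.pi * (x - round x) / 2 = Real.pi * (x - round x) by ring, abs_mul,
      abs_of_pos hpi]
    nlinarith)
  rw [show |2 * Real.pi * (x - round x) / 2| = Real.pi * |x - round x| by
    rw [show 2 * Real.pi * (x - round x) / 2 = Real.pi * (x - round x) by ring, abs_mul,
      abs_of_pos hpi]] at h
  rw [norm_mul, Real.norm_eq_abs, Real.norm_eq_abs, abs_two]
  have h' : 2 / Real.pi * (Real.pi * |x - round x|) = 2 * |x - round x| := by field_simp
  rw [h'] at h
  unfold distNearestInt
  linarith

/-- The geometric sum bound for additive characters. -/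
theorem norm_sum_expChar_le (Q : ℕ) {x : ℝ} (hx : 0 < distNearestInt x) :
    ‖∑ a ∈ Finset.range Q, expChar (a * x)‖ ≤ (distNearestInt x)⁻¹ := by
  simp_rw [expChar_natCast_mul]
  have h := congrArg norm (geom_sum_mul (expChar x) Q)
  rw [norm_mul] at h
  have h2 : ‖expChar x ^ Q - 1‖ ≤ 2 := by
    refine (norm_sub_le _ _).trans ?_
    rw [norm_pow, norm_expChar, one_pow, norm_one]
    norm_num
  have h3 := distNearestInt_le_norm_expChar_sub_one x
  rw [← one_div, le_div_iff₀ hx]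
  have h4 := norm_nonneg (∑ i ∈ Finset.range Q, expChar x ^ i)
  nlinarith

theorem half_le_norm_sum_expChar {H : ℕ} {x : ℝ} (hx : distNearestInt x ≤ 1 / (6 * H)) :
    (H : ℝ) / 2 ≤ ‖∑ h ∈ Finset.range H, expChar (h * x)‖ := by
  refine le_trans ?_ ((le_abs_self _).trans (Complex.abs_re_le_norm _))
  rw [Complex.re_sum]
  have : (H : ℝ) / 2 = ∑ _h ∈ Finset.range H, (1 / 2 : ℝ) := by
    simp; ring
  rw [this]
  refine Finset.sum_le_sum fun h hh => ?_
  have hH : (h : ℝ) < H := by exact_mod_cast Finset.mem_range.1 hh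
  have hh0 : (0 : ℝ) ≤ h := Nat.cast_nonneg h
  have e : expChar (h * x) = expChar (h * (x - round x)) := by
    rw [← expChar_sub_intCast (h * x) (h * round x)]
    congr 1
    push_cast
    ring
  rw [e, re_expChar, ← Real.cos_abs, ← Real.cos_pi_div_three]
  have hpi := Real.pi_pos
  unfold distNearestInt at hx
  have hle : h * |x - round x| ≤ 1 / 6 := by
    calc h * |x - round x| ≤ H * (1 / (6 * H)) := by gcongr
      _ = 1 / 6 := by
        have : (H : ℝ) ≠ 0 := by linarith
        field_simp
  refine Real.cos_le_cos_of_nonneg_of_le_pi (abs_nonneg _) (by linarith) ?_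
  rw [abs_mul (2 * Real.pi), abs_mul (h : ℝ), abs_of_pos (by positivity : 0 < 2 * Real.pi),
    abs_of_nonneg hh0]
  nlinarith

/-- The product `∏ ‖A_i · k‖` of the distances to the nearest integer of the linear forms given
by the rows of `A`. -/
noncomputable def formProd {d n : ℕ} (A : Matrix (Fin d) (Fin n) ℝ) (k : Fin n → ℤ) : ℝ :=
  ∏ i, distNearestInt (∑ j, A i j * (k j : ℝ))

theorem formProd_nonneg {d n : ℕ} (A : Matrix (Fin d) (Fin n) ℝ) (k : Fin n → ℤ) :
    0 ≤ formProd A k := Finset.prod_nonneg fun _ _ => distNearestInt_nonneg _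

theorem formProd_le_one {d n : ℕ} (A : Matrix (Fin d) (Fin n) ℝ) (k : Fin n → ℤ) :
    formProd A k ≤ 1 :=
  Finset.prod_le_one (fun _ _ => distNearestInt_nonneg _)
    fun _ _ => (distNearestInt_le_half _).trans (by norm_num)

theorem distNearestInt_pos_of_formProd_pos {d n : ℕ} {A : Matrix (Fin d) (Fin n) ℝ}
    {k : Fin n → ℤ} (h : 0 < formProd A k) (i : Fin d) :
    0 < distNearestInt (∑ j, A i j * (k j : ℝ)) :=
  lt_of_le_of_ne (distNearestInt_nonneg _) fun h0 =>
    h.ne' (Finset.prod_eq_zero (Finset.mem_univ i) h0.symm)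

/-- The integer vectors of sup norm at most `K`. -/
noncomputable def intBox (n : ℕ) (K : ℝ) : Finset (Fin n → ℤ) :=
  Fintype.piFinset fun _ => Finset.Icc (-⌊K⌋) ⌊K⌋

theorem mem_intBox {n : ℕ} {K : ℝ} {k : Fin n → ℤ} :
    k ∈ intBox n K ↔ ∀ j, |(k j : ℝ)| ≤ K := by
  simp only [intBox, Fintype.mem_piFinset, Finset.mem_Icc, abs_le]
  refine forall_congr' fun j => and_congr ?_ Int.le_floor
  rw [neg_le, Int.le_floor, neg_le]
  push_cast
  rw [neg_le]

/-- The sum over the nonzero integer vectors `k` with `|k|_∞ ≤ K` of `∏ ‖A_i · k‖⁻¹`. -/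
noncomputable def recipSum {d n : ℕ} (A : Matrix (Fin d) (Fin n) ℝ) (K : ℝ) : ℝ :=
  ∑ k ∈ (intBox n K).filter (· ≠ 0), (formProd A k)⁻¹

theorem recipSum_mono {d n : ℕ} (A : Matrix (Fin d) (Fin n) ℝ) {K K' : ℝ} (h : K ≤ K') :
    recipSum A K ≤ recipSum A K' := by
  refine Finset.sum_le_sum_of_subset_of_nonneg ?_ fun k _ _ => inv_nonneg.2 (formProd_nonneg A k)
  intro k hk
  simp only [Finset.mem_filter, mem_intBox] at hk ⊢
  exact ⟨fun j => (hk.1 j).trans h, hk.2⟩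

theorem norm_sum_piFinset_expChar_le {d n : ℕ} {A : Matrix (Fin d) (Fin n) ℝ} (β : Fin n → ℝ)
    (Q : ℕ) {k : Fin n → ℤ} (hk : 0 < formProd A k) :
    ‖∑ a ∈ Fintype.piFinset (fun _ : Fin d => Finset.range Q),
      expChar (∑ j, (k j : ℝ) * (β j + ∑ i, (a i : ℝ) * A i j))‖ ≤ (formProd A k)⁻¹ := by
  have e : ∀ a : Fin d → ℕ, expChar (∑ j, (k j : ℝ) * (β j + ∑ i, (a i : ℝ) * A i j)) =
      expChar (∑ j, (k j : ℝ) * β j) *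
        ∏ i, expChar (a i * ∑ j, A i j * (k j : ℝ)) := by
    intro a
    rw [← expChar_sum, ← expChar_add]
    congr 1
    simp_rw [mul_add, Finset.sum_add_distrib, Finset.mul_sum]
    congr 1
    rw [Finset.sum_comm]
    exact Finset.sum_congr rfl fun i _ => Finset.sum_congr rfl fun j _ => by ring
  simp_rw [e]
  rw [← Finset.mul_sum, norm_mul, norm_expChar, one_mul,
    ← Finset.prod_univ_sum (fun _ : Fin d => Finset.range Q)
      (fun i a => expChar ((a : ℝ) * ∑ j, A i j * (k j : ℝ))), norm_prod, formProd,
    ← Finset.prod_inv_distrib]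
  exact Finset.prod_le_prod (fun _ _ => norm_nonneg _)
    fun i _ => norm_sum_expChar_le Q (distNearestInt_pos_of_formProd_pos hk i)

theorem normSq_sum_expChar {n : ℕ} (B : Finset (Fin n → ℕ)) (t : Fin n → ℝ) :
    ((‖∑ h ∈ B, expChar (∑ j, (h j : ℝ) * t j)‖ ^ 2 : ℝ) : ℂ) =
      ∑ h ∈ B, ∑ h' ∈ B, expChar (∑ j, (((h j : ℤ) - (h' j : ℤ) : ℤ) : ℝ) * t j) := by
  rw [Complex.ofReal_pow, ← Complex.mul_conj', map_sum, Finset.sum_mul_sum]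
  refine Finset.sum_congr rfl fun h _ => Finset.sum_congr rfl fun h' _ => ?_
  rw [conj_expChar, ← expChar_add, ← Finset.sum_neg_distrib, ← Finset.sum_add_distrib]
  congr 1
  refine Finset.sum_congr rfl fun j _ => ?_
  push_cast
  ring

open Classical in
/-- Counting integer points `a` in a box with `aA + β` close to an integer point, by means of
Fejér kernels. -/
theorem card_filter_near_le {d n : ℕ} {A : Matrix (Fin d) (Fin n) ℝ} (β : Fin n → ℝ)
    (hA : ∀ k, k ≠ 0 → 0 < formProd A k) (Q : ℕ) {H : ℕ} (hH : 0 < H) :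
    (((Fintype.piFinset (fun _ : Fin d => Finset.range Q)).filter
      (fun a => ∀ j, distNearestInt (β j + ∑ i, (a i : ℝ) * A i j) ≤ 1 / (6 * H))).card : ℝ) ≤
      4 ^ n / H ^ n * (Q ^ d + recipSum A H) := by
  set S := Fintype.piFinset (fun _ : Fin d => Finset.range Q) with hS
  set t : (Fin d → ℕ) → Fin n → ℝ := fun a j => β j + ∑ i, (a i : ℝ) * A i j with ht
  set B := Fintype.piFinset (fun _ : Fin n => Finset.range H) with hB
  set G := S.filter (fun a => ∀ j, distNearestInt (t a j) ≤ 1 / (6 * H)) with hG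
  have hHr : (0 : ℝ) < H := by exact_mod_cast hH
  have hlow : ∀ a ∈ G, ((H : ℝ) / 2) ^ n ≤ ‖∑ h ∈ B, expChar (∑ j, (h j : ℝ) * t a j)‖ := by
    intro a ha
    simp_rw [expChar_sum]
    rw [hB, ← Finset.prod_univ_sum (fun _ : Fin n => Finset.range H)
      (fun j h => expChar ((h : ℝ) * t a j)), norm_prod]
    calc ((H : ℝ) / 2) ^ n = ∏ _j : Fin n, ((H : ℝ) / 2) := by simp [div_pow]
      _ ≤ _ := Finset.prod_le_prod (fun _ _ => by positivity)
        fun j _ => half_le_norm_sum_expChar ((Finset.mem_filter.1 ha).2 j)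
  set W : (Fin n → ℤ) → ℝ := fun k => if k = 0 then (Q : ℝ) ^ d else (formProd A k)⁻¹ with hW
  have hW0 : ∀ k, 0 ≤ W k := by
    intro k
    simp only [hW]
    split_ifs
    · positivity
    · exact inv_nonneg.2 (formProd_nonneg A k)
  have hWb : ∀ k, ‖∑ a ∈ S, expChar (∑ j, (k j : ℝ) * t a j)‖ ≤ W k := by
    intro k
    simp only [hW]
    split_ifs with h
    · subst h
      simp [expChar_zero, hS]
    · exact norm_sum_piFinset_expChar_le β Q (hA k h)
  have hWsum : ∑ k ∈ intBox n H, W k = Q ^ d + recipSum A H := by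
    have h0 : (0 : Fin n → ℤ) ∈ intBox n H := mem_intBox.2 fun j => by simp
    rw [recipSum, ← Finset.add_sum_erase _ _ h0]
    congr 1
    · simp [hW]
    · refine Finset.sum_congr (by ext; simp [and_comm]) fun k hk => ?_
      simp only [hW, if_neg (Finset.mem_filter.1 hk).2]
  have hup : ∑ a ∈ S, ‖∑ h ∈ B, expChar (∑ j, (h j : ℝ) * t a j)‖ ^ 2 ≤
      H ^ n * (Q ^ d + recipSum A H) := by
    have e : ((∑ a ∈ S, ‖∑ h ∈ B, expChar (∑ j, (h j : ℝ) * t a j)‖ ^ 2 : ℝ) : ℂ) =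
        ∑ h ∈ B, ∑ h' ∈ B, ∑ a ∈ S,
          expChar (∑ j, (((h j : ℤ) - (h' j : ℤ) : ℤ) : ℝ) * t a j) := by
      rw [Complex.ofReal_sum]
      simp_rw [normSq_sum_expChar]
      rw [Finset.sum_comm]
      exact Finset.sum_congr rfl fun h _ => Finset.sum_comm
    have hnn : 0 ≤ ∑ a ∈ S, ‖∑ h ∈ B, expChar (∑ j, (h j : ℝ) * t a j)‖ ^ 2 :=
      Finset.sum_nonneg fun _ _ => by positivity
    have e2 := congrArg norm e
    rw [Complex.norm_of_nonneg hnn] at e2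
    rw [e2]
    calc _ ≤ ∑ h ∈ B, ∑ h' ∈ B, W (fun j => (h j : ℤ) - (h' j : ℤ)) :=
          (norm_sum_le _ _).trans (Finset.sum_le_sum fun h _ =>
            (norm_sum_le _ _).trans (Finset.sum_le_sum fun h' _ => hWb _))
      _ ≤ ∑ h ∈ B, ∑ k ∈ intBox n H, W k := by
          refine Finset.sum_le_sum fun h hh => ?_
          rw [← Finset.sum_image (f := W) (s := B)
            (g := fun (h' : Fin n → ℕ) j => (h j : ℤ) - (h' j : ℤ))]
          · refine Finset.sum_le_sum_of_subset_of_nonneg ?_ fun k _ _ => hW0 k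
            intro k hk
            obtain ⟨h', hh', rfl⟩ := Finset.mem_image.1 hk
            refine mem_intBox.2 fun j => ?_
            have h1 := Finset.mem_range.1 (Fintype.mem_piFinset.1 hh j)
            have h2 := Finset.mem_range.1 (Fintype.mem_piFinset.1 hh' j)
            have h3 : |(h j : ℤ) - (h' j : ℤ)| ≤ (H : ℤ) := by rw [abs_le]; omega
            exact_mod_cast h3
          · intro x _ y _ hxy
            funext j
            have := congrFun hxy j
            simp only at this
            omega
      _ = _ := by
          rw [hWsum]
          simp [hB, mul_add]
  have hcard : (G.card : ℝ) * (((H : ℝ) / 2) ^ n) ^ 2 ≤ H ^ n * (Q ^ d + recipSum A H) := by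
    refine le_trans ?_ hup
    rw [← nsmul_eq_mul]
    refine (Finset.card_nsmul_le_sum G _ _ fun a ha => ?_).trans
      (Finset.sum_le_sum_of_subset_of_nonneg (Finset.filter_subset _ _) fun _ _ _ => by positivity)
    exact pow_le_pow_left₀ (by positivity) (hlow a ha) 2
  rw [div_mul_eq_mul_div, le_div_iff₀ (by positivity)]
  have e4 : (((H : ℝ) / 2) ^ n) ^ 2 = H ^ n * H ^ n / 4 ^ n := by
    rw [show (4 : ℝ) = 2 * 2 by norm_num, div_pow, div_pow, mul_pow, pow_two, pow_two]
  rw [e4, mul_div_assoc', div_le_iff₀ (by positivity)] at hcard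
  have hp : (0 : ℝ) < H ^ n := by positivity
  refine le_of_mul_le_mul_left ?_ hp
  linarith

theorem distNearestInt_sub_le {x y : ℝ} {m : ℕ}
    (hx : (1 / 2 : ℝ) ^ (m + 1) < distNearestInt x ∧ distNearestInt x ≤ (1 / 2) ^ m)
    (hy : (1 / 2 : ℝ) ^ (m + 1) < distNearestInt y ∧ distNearestInt y ≤ (1 / 2) ^ m)
    (hs : 0 ≤ x - round x ↔ 0 ≤ y - round y) :
    distNearestInt (x - y) ≤ (1 / 2) ^ (m + 1) := by
  refine (distNearestInt_le_abs_sub_intCast _ (round x - round y)).trans ?_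
  have e : x - y - ((round x - round y : ℤ) : ℝ) = (x - round x) - (y - round y) := by
    push_cast
    ring
  rw [e]
  unfold distNearestInt at hx hy
  have hp : (1 / 2 : ℝ) ^ m = 2 * (1 / 2) ^ (m + 1) := by rw [pow_succ]; ring
  by_cases h : 0 ≤ x - round x
  · rw [abs_of_nonneg h] at hx
    rw [abs_of_nonneg (hs.1 h)] at hy
    rw [abs_le]
    constructor <;> linarith [hx.1, hx.2, hy.1, hy.2]
  · have h' := mt hs.2 h
    rw [abs_of_neg (not_le.1 h)] at hx
    rw [abs_of_neg (not_le.1 h')] at hy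
    rw [abs_le]
    constructor <;> linarith [hx.1, hx.2, hy.1, hy.2]

theorem card_Icc_floor_neg_le {r : ℝ} (hr : 1 ≤ r) :
    ((Finset.Icc ⌊-r⌋ ⌊r⌋).card : ℝ) ≤ 4 * r := by
  have h1 := Int.floor_le r
  have h2 := Int.lt_floor_add_one (-r)
  have h3 : ⌊-r⌋ ≤ ⌊r⌋ := Int.floor_mono (by linarith)
  rw [Int.card_Icc]
  have h4 : (((⌊r⌋ + 1 - ⌊-r⌋).toNat : ℤ) : ℝ) = ((⌊r⌋ + 1 - ⌊-r⌋ : ℤ) : ℝ) := by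
    rw [Int.toNat_of_nonneg (by omega)]
  rw [Int.cast_natCast] at h4
  rw [h4]
  push_cast
  linarith

/-- If `∏ ‖A_i · k‖` is bounded below in terms of `|k|_∞`, then few integer vectors `k` in a box
have all `‖A_i · k‖` in prescribed dyadic intervals. -/
theorem card_dyadic_le {d n : ℕ} (hd : 1 ≤ d) {A : Matrix (Fin d) (Fin n) ℝ} {Δ K : ℝ}
    (hΔ : 0 < Δ) (hK : 0 < K)
    (hA : ∀ r : ℝ, 1 ≤ r → ∀ k : Fin n → ℤ, k ≠ 0 → (∀ j, |(k j : ℝ)| ≤ K / r) →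
      Δ * r ^ ((n : ℝ) + 1 / 2) ≤ formProd A k)
    (m : Fin d → ℕ) (F : Finset (Fin n → ℤ))
    (hF : ∀ k ∈ F, k ≠ 0 ∧ (∀ j, |(k j : ℝ)| ≤ K) ∧
      ∀ i, (1 / 2 : ℝ) ^ (m i + 1) < distNearestInt (∑ j, A i j * (k j : ℝ)) ∧
        distNearestInt (∑ j, A i j * (k j : ℝ)) ≤ (1 / 2) ^ (m i)) :
    (F.card : ℝ) ≤
      2 ^ d * 4 ^ n * (((1 / 2 : ℝ) ^ (∑ i, m i)) / Δ) ^ ((n : ℝ) / ((n : ℝ) + 1 / 2)) := by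
  classical
  set V : ℝ := (1 / 2 : ℝ) ^ (∑ i, m i) with hV
  have hVpos : 0 < V := by positivity
  rcases F.eq_empty_or_nonempty with rfl | ⟨k₀, hk₀⟩
  · simp only [Finset.card_empty, Nat.cast_zero]
    positivity
  have hΔV : Δ ≤ V := by
    obtain ⟨h0, hb, hdy⟩ := hF k₀ hk₀
    have h1 := hA 1 le_rfl k₀ h0 (by simpa using hb)
    rw [Real.one_rpow, mul_one] at h1
    refine h1.trans ?_
    rw [hV, ← Finset.prod_pow_eq_pow_sum]
    exact Finset.prod_le_prod (fun _ _ => distNearestInt_nonneg _) fun i _ => (hdy i).2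
  set τ : ℝ := (n : ℝ) + 1 / 2 with hτ
  have hτpos : 0 < τ := by positivity
  set r : ℝ := (V / Δ) ^ (1 / τ) with hr
  have hr1 : 1 ≤ r := Real.one_le_rpow ((one_le_div hΔ).2 hΔV) (by positivity)
  have hrpos : 0 < r := by linarith
  have hrτ : Δ * r ^ τ = V := by
    rw [hr, ← Real.rpow_mul (by positivity), one_div_mul_cancel hτpos.ne', Real.rpow_one]
    field_simp
  have hrn : (V / Δ) ^ ((n : ℝ) / τ) = r ^ n := by
    rw [hr, ← Real.rpow_natCast, ← Real.rpow_mul (by positivity)]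
    congr 1
    ring
  rw [hrn]
  set I := Finset.Icc ⌊-r⌋ ⌊r⌋ with hI
  let x : (Fin n → ℤ) → Fin d → ℝ := fun k i => ∑ j, A i j * (k j : ℝ)
  let f : (Fin n → ℤ) → (Fin d → Bool) × (Fin n → ℤ) := fun k =>
    (fun i => decide (0 ≤ x k i - round (x k i)), fun j => ⌊(k j : ℝ) * (r / K)⌋)
  have hcard : F.card ≤ ((Finset.univ : Finset (Fin d → Bool)) ×ˢ
      Fintype.piFinset (fun _ : Fin n => I)).card := by
    refine Finset.card_le_card_of_injOn f ?_ ?_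
    · intro k hk
      simp only [Finset.coe_product, Finset.coe_univ, Set.mem_prod, Set.mem_univ, true_and,
        Finset.mem_coe, Fintype.mem_piFinset, f]
      intro j
      have hb := abs_le.1 ((hF k hk).2.1 j)
      have hKr : K * (r / K) = r := by field_simp
      have hrK : 0 < r / K := by positivity
      rw [hI, Finset.mem_Icc]
      exact ⟨Int.floor_mono (by nlinarith), Int.floor_mono (by nlinarith)⟩
    · intro k hk k' hk' hkk
      by_contra hne
      obtain ⟨hk0, hkb, hkd⟩ := hF k hk
      obtain ⟨hk0', hkb', hkd'⟩ := hF k' hk'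
      have h1 : ∀ i, (0 ≤ x k i - round (x k i) ↔ 0 ≤ x k' i - round (x k' i)) := fun i =>
        decide_eq_decide.1 (congrFun (congrArg Prod.fst hkk) i)
      have h2 : ∀ j, ⌊(k j : ℝ) * (r / K)⌋ = ⌊(k' j : ℝ) * (r / K)⌋ := fun j =>
        congrFun (congrArg Prod.snd hkk) j
      have h3 := hA r hr1 (k - k') (sub_ne_zero.2 hne) (fun j => by
        have h4 := (Int.abs_sub_lt_one_of_floor_eq_floor (h2 j)).le
        rw [← sub_mul, abs_mul, abs_of_pos (by positivity : 0 < r / K)] at h4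
        rw [Pi.sub_apply, Int.cast_sub, le_div_iff₀ hrpos]
        rw [mul_div_assoc', div_le_one hK] at h4
        exact h4)
      rw [hrτ] at h3
      have h5 : formProd A (k - k') ≤ ∏ i, (1 / 2 : ℝ) ^ (m i + 1) := by
        refine Finset.prod_le_prod (fun _ _ => distNearestInt_nonneg _) fun i _ => ?_
        have e : ∑ j, A i j * (((k - k') j : ℤ) : ℝ) = x k i - x k' i := by
          simp only [x, ← Finset.sum_sub_distrib, Pi.sub_apply, Int.cast_sub, mul_sub]
        rw [e]
        exact distNearestInt_sub_le (hkd i) (hkd' i) (h1 i)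
      have h6 : ∏ i, (1 / 2 : ℝ) ^ (m i + 1) = V * (1 / 2) ^ d := by
        rw [Finset.prod_pow_eq_pow_sum, Finset.sum_add_distrib, pow_add]
        simp [hV]
      have h7 : (1 / 2 : ℝ) ^ d < 1 := pow_lt_one₀ (by norm_num) (by norm_num) (by omega)
      nlinarith
  calc (F.card : ℝ) ≤ ((2 ^ d * I.card ^ n : ℕ) : ℝ) := by
        refine Nat.cast_le.2 (hcard.trans_eq ?_)
        simp [Finset.card_product]
    _ = 2 ^ d * (I.card : ℝ) ^ n := by push_cast; ring
    _ ≤ 2 ^ d * (4 * r) ^ n := by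
        gcongr
        exact card_Icc_floor_neg_le hr1
    _ = _ := by rw [mul_pow]; ring

theorem sum_pow_sum_le {b : ℝ} (hb : 1 < b) (e J : ℕ) :
    ∑ m ∈ (Fintype.piFinset (fun _ : Fin (e + 1) => Finset.range (J + 1))).filter
      (fun m => ∑ i, m i ≤ J), b ^ (∑ i, m i) ≤ ((J : ℝ) + 1) ^ e * (b ^ (J + 1) / (b - 1)) := by
  classical
  let f : (Fin (e + 1) → ℕ) → (Fin e → ℕ) × ℕ := fun m => (fun i => m i.succ, ∑ i, m i)
  have hinj : Function.Injective f := by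
    intro m m' h
    have h1 : ∀ i : Fin e, m i.succ = m' i.succ := fun i => congrFun (congrArg Prod.fst h) i
    have h2 : ∑ i, m i = ∑ i, m' i := congrArg Prod.snd h
    rw [Fin.sum_univ_succ, Fin.sum_univ_succ, Finset.sum_congr rfl fun i _ => h1 i] at h2
    funext i
    refine Fin.cases (by omega) h1 i
  calc _ = ∑ p ∈ ((Fintype.piFinset (fun _ : Fin (e + 1) => Finset.range (J + 1))).filter
          (fun m => ∑ i, m i ≤ J)).image f, b ^ p.2 := by
        rw [Finset.sum_image hinj.injOn]
    _ ≤ ∑ p ∈ (Fintype.piFinset (fun _ : Fin e => Finset.range (J + 1))) ×ˢ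
          Finset.range (J + 1), b ^ p.2 := by
        refine Finset.sum_le_sum_of_subset_of_nonneg ?_ fun _ _ _ => by positivity
        intro p hp
        obtain ⟨m, hm, rfl⟩ := Finset.mem_image.1 hp
        rw [Finset.mem_filter, Fintype.mem_piFinset] at hm
        rw [Finset.mem_product, Fintype.mem_piFinset, Finset.mem_range]
        exact ⟨fun i => hm.1 i.succ, Nat.lt_succ_of_le hm.2⟩
    _ = ((J : ℝ) + 1) ^ e * ∑ s ∈ Finset.range (J + 1), b ^ s := by
        rw [Finset.sum_product]
        simp
    _ ≤ _ := by
        rw [geom_sum_eq hb.ne']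
        have : 0 < b - 1 := by linarith
        gcongr
        linarith

theorem recipSum_le {d n : ℕ} (hd : 1 ≤ d) :
    ∃ C : ℝ, 0 < C ∧ ∀ (A : Matrix (Fin d) (Fin n) ℝ) (Δ K : ℝ), 0 < Δ → 0 < K →
      (∀ r : ℝ, 1 ≤ r → ∀ k : Fin n → ℤ, k ≠ 0 → (∀ j, |(k j : ℝ)| ≤ K / r) →
        Δ * r ^ ((n : ℝ) + 1 / 2) ≤ formProd A k) →
      ∀ J : ℕ, (2 : ℝ) ^ J ≤ 1 / Δ → 1 / Δ < 2 ^ (J + 1) →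
        recipSum A K ≤ C * ((J : ℝ) + 1) ^ (d - 1) / Δ := by
  classical
  obtain ⟨e, rfl⟩ : ∃ e, d = e + 1 := ⟨d - 1, by omega⟩
  set θ : ℝ := (n : ℝ) / ((n : ℝ) + 1 / 2) with hθ
  have hθ1 : 0 < 1 - θ := by
    rw [hθ, sub_pos, div_lt_one (by positivity)]
    linarith
  set b : ℝ := 2 ^ (1 - θ) with hb
  have hb1 : 1 < b := Real.one_lt_rpow (by norm_num) hθ1
  have hb0 : 0 < b - 1 := by linarith
  refine ⟨2 ^ (e + 1) * (2 ^ (e + 1) * 4 ^ n) * (b / (b - 1)), by positivity, ?_⟩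
  intro A Δ K hΔ hK hA J hJ hJ'
  have hlow : ∀ k ∈ (intBox n K).filter (· ≠ 0), Δ ≤ formProd A k := by
    intro k hk
    rw [Finset.mem_filter, mem_intBox] at hk
    simpa using hA 1 le_rfl k hk.2 (by simpa using hk.1)
  have hex : ∀ k : Fin n → ℤ, ∃ m : Fin (e + 1) → ℕ, k ∈ (intBox n K).filter (· ≠ 0) →
      ∀ i, (1 / 2 : ℝ) ^ (m i + 1) < distNearestInt (∑ j, A i j * (k j : ℝ)) ∧
        distNearestInt (∑ j, A i j * (k j : ℝ)) ≤ (1 / 2) ^ (m i) := by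
    intro k
    by_cases hk : k ∈ (intBox n K).filter (· ≠ 0)
    · have hpos := distNearestInt_pos_of_formProd_pos (hΔ.trans_le (hlow k hk))
      choose m hm using fun i => exists_nat_pow_near_of_lt_one (hpos i)
        ((distNearestInt_le_half _).trans (by norm_num)) (by norm_num : (0 : ℝ) < 1 / 2)
        (by norm_num)
      exact ⟨m, fun _ => hm⟩
    · exact ⟨0, fun h => absurd h hk⟩
  choose m hm using hex
  set M := (Fintype.piFinset (fun _ : Fin (e + 1) => Finset.range (J + 1))).filter
      (fun m => ∑ i, m i ≤ J) with hM
  have hmaps : ∀ k ∈ (intBox n K).filter (· ≠ 0), m k ∈ M := by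
    intro k hk
    have h1 : Δ ≤ (1 / 2 : ℝ) ^ (∑ i, m k i) := by
      refine (hlow k hk).trans ?_
      rw [← Finset.prod_pow_eq_pow_sum]
      exact Finset.prod_le_prod (fun _ _ => distNearestInt_nonneg _) fun i _ => (hm k hk i).2
    have h2 : (2 : ℝ) ^ (∑ i, m k i) ≤ 1 / Δ := by
      rw [one_div_pow] at h1
      rwa [le_one_div (by positivity) hΔ]
    have h3 : ∑ i, m k i < J + 1 :=
      (pow_lt_pow_iff_right₀ (by norm_num : (1 : ℝ) < 2)).1 (h2.trans_lt hJ')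
    rw [hM, Finset.mem_filter, Fintype.mem_piFinset]
    refine ⟨fun i => Finset.mem_range.2 ?_, by omega⟩
    exact (Finset.single_le_sum (f := m k) (fun _ _ => Nat.zero_le _) (Finset.mem_univ i)).trans_lt
      h3
  have hfib : ∀ l ∈ M, ∑ k ∈ ((intBox n K).filter (· ≠ 0)).filter (fun k => m k = l),
      (formProd A k)⁻¹ ≤
      2 ^ (e + 1) * (2 ^ (e + 1) * 4 ^ n) * (Δ ^ (-θ) * b ^ (∑ i, l i)) := by
    intro l _
    set F := ((intBox n K).filter (· ≠ 0)).filter (fun k => m k = l) with hF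
    have hcard := card_dyadic_le hd hΔ hK hA l F (by
      intro k hk
      rw [hF, Finset.mem_filter] at hk
      have h1 := hm k hk.1
      rw [hk.2] at h1
      have h2 := hk.1
      rw [Finset.mem_filter, mem_intBox] at h2
      exact ⟨h2.2, h2.1, h1⟩)
    have hterm : ∀ k ∈ F, (formProd A k)⁻¹ ≤ 2 ^ (e + 1) * 2 ^ (∑ i, l i) := by
      intro k hk
      rw [hF, Finset.mem_filter] at hk
      have h1 := hm k hk.1
      rw [hk.2] at h1
      have h2 : (1 / 2 : ℝ) ^ ((∑ i, l i) + (e + 1)) ≤ formProd A k := by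
        have h3 : (1 / 2 : ℝ) ^ ((∑ i, l i) + (e + 1)) = ∏ i, (1 / 2 : ℝ) ^ (l i + 1) := by
          rw [Finset.prod_pow_eq_pow_sum, Finset.sum_add_distrib]
          simp
        rw [h3]
        exact Finset.prod_le_prod (fun _ _ => by positivity) fun i _ => (h1 i).1.le
      refine (inv_anti₀ (by positivity) h2).trans_eq ?_
      rw [one_div, inv_pow, inv_inv, pow_add]
      ring
    have hpow : ((1 / 2 : ℝ) ^ (∑ i, l i) / Δ) ^ θ * 2 ^ (∑ i, l i) =
        Δ ^ (-θ) * b ^ (∑ i, l i) := by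
      generalize (∑ i, l i) = s
      rw [Real.div_rpow (by positivity) hΔ.le, Real.rpow_neg hΔ.le, one_div, inv_pow,
        Real.inv_rpow (by positivity), hb, ← Real.rpow_natCast (2 ^ (1 - θ)), ← Real.rpow_mul
        (by norm_num), ← Real.rpow_natCast 2, ← Real.rpow_mul (by norm_num),
        show (1 - θ) * (s : ℝ) = s - s * θ by ring, Real.rpow_sub (by norm_num)]
      field_simp
    calc _ ≤ F.card • ((2 : ℝ) ^ (e + 1) * 2 ^ (∑ i, l i)) := Finset.sum_le_card_nsmul _ _ _ hterm
      _ = F.card * ((2 : ℝ) ^ (e + 1) * 2 ^ (∑ i, l i)) := nsmul_eq_mul _ _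
      _ ≤ (2 ^ (e + 1) * 4 ^ n * ((1 / 2 : ℝ) ^ (∑ i, l i) / Δ) ^ θ) *
          ((2 : ℝ) ^ (e + 1) * 2 ^ (∑ i, l i)) := by gcongr
      _ = 2 ^ (e + 1) * (2 ^ (e + 1) * 4 ^ n) *
          (((1 / 2 : ℝ) ^ (∑ i, l i) / Δ) ^ θ * 2 ^ (∑ i, l i)) := by ring
      _ = _ := by rw [hpow]
  have hbJ : Δ ^ (-θ) * b ^ J ≤ 1 / Δ := by
    have h1 : b ^ J ≤ (1 / Δ) ^ (1 - θ) := by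
      rw [hb, ← Real.rpow_natCast, ← Real.rpow_mul (by norm_num), mul_comm (1 - θ),
        Real.rpow_mul (by norm_num), Real.rpow_natCast]
      exact Real.rpow_le_rpow (by positivity) hJ hθ1.le
    calc Δ ^ (-θ) * b ^ J ≤ Δ ^ (-θ) * (1 / Δ) ^ (1 - θ) := by gcongr
      _ = 1 / Δ := by
        rw [one_div, Real.inv_rpow hΔ.le, ← Real.rpow_neg hΔ.le, ← Real.rpow_add hΔ,
          show -θ + -(1 - θ) = -1 by ring, Real.rpow_neg_one]
  calc recipSum A K = ∑ l ∈ M, ∑ k ∈ ((intBox n K).filter (· ≠ 0)).filter (fun k => m k = l),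
        (formProd A k)⁻¹ := (Finset.sum_fiberwise_of_maps_to hmaps _).symm
    _ ≤ ∑ l ∈ M, 2 ^ (e + 1) * (2 ^ (e + 1) * 4 ^ n) * (Δ ^ (-θ) * b ^ (∑ i, l i)) :=
        Finset.sum_le_sum hfib
    _ = 2 ^ (e + 1) * (2 ^ (e + 1) * 4 ^ n) * (Δ ^ (-θ) * ∑ l ∈ M, b ^ (∑ i, l i)) := by
        rw [← Finset.mul_sum, ← Finset.mul_sum]
    _ ≤ 2 ^ (e + 1) * (2 ^ (e + 1) * 4 ^ n) *
        (Δ ^ (-θ) * (((J : ℝ) + 1) ^ e * (b ^ (J + 1) / (b - 1)))) := by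
        gcongr
        exact sum_pow_sum_le hb1 e J
    _ = 2 ^ (e + 1) * (2 ^ (e + 1) * 4 ^ n) * (b / (b - 1)) * ((J : ℝ) + 1) ^ e *
        (Δ ^ (-θ) * b ^ J) := by
        rw [pow_succ b]
        ring
    _ ≤ 2 ^ (e + 1) * (2 ^ (e + 1) * 4 ^ n) * (b / (b - 1)) * ((J : ℝ) + 1) ^ e * (1 / Δ) := by
        gcongr
    _ = _ := by
        rw [Nat.add_sub_cancel]
        ring

theorem one_add_log_rpow_le {σ η : ℝ} (hσ : 0 < σ) (hη : 0 < η) :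
    ∃ C : ℝ, 0 < C ∧ ∀ u : ℝ, 1 ≤ u → (1 + Real.log u) ^ σ ≤ C * u ^ η := by
  have hε : 0 < η / σ := by positivity
  refine ⟨(1 + 1 / (η / σ)) ^ σ, by positivity, fun u hu => ?_⟩
  have hlog := Real.log_nonneg hu
  have h1 := Real.log_le_rpow_div (by linarith : 0 ≤ u) hε
  have h2 : 1 ≤ u ^ (η / σ) := Real.one_le_rpow hu hε.le
  have h3 : 1 + Real.log u ≤ (1 + 1 / (η / σ)) * u ^ (η / σ) := by
    rw [add_mul, one_mul, div_mul_eq_mul_div, one_mul]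
    linarith
  calc (1 + Real.log u) ^ σ ≤ ((1 + 1 / (η / σ)) * u ^ (η / σ)) ^ σ :=
        Real.rpow_le_rpow (by linarith) h3 hσ.le
    _ = _ := by
        rw [Real.mul_rpow (by positivity) (by positivity), ← Real.rpow_mul (by linarith),
          div_mul_cancel₀ _ hσ.ne']

theorem one_add_log_mul_le {t u : ℝ} (ht : 1 ≤ t) (hu : 1 ≤ u) :
    1 + Real.log (t * u) ≤ (1 + Real.log t) * (1 + Real.log u) := by
  rw [Real.log_mul (by linarith) (by linarith)]
  nlinarith [mul_nonneg (Real.log_nonneg ht) (Real.log_nonneg hu)]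

theorem intSupNorm_le_iff {n : ℕ} {k : Fin n → ℤ} {T : ℝ} (hT : 0 ≤ T) :
    intSupNorm k ≤ T ↔ ∀ j, |(k j : ℝ)| ≤ T := by
  rw [intSupNorm, pi_norm_le_iff_of_nonneg hT]
  rfl

/-- If the multiplicative inequality has only finitely many solutions, then no linear form given
by `A` takes an integer value at a nonzero integer vector. -/
theorem formProd_pos_of_finite {d n : ℕ} {A : Matrix (Fin d) (Fin n) ℝ} {E σ : ℝ}
    (hfin : {q : Fin n → ℤ | ¬ (∀ j, |q j| ≤ 1) ∧
      formProd A q ≤ intSupNorm q ^ (-E) * Real.log (intSupNorm q) ^ σ}.Finite)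
    {k : Fin n → ℤ} (hk : k ≠ 0) : 0 < formProd A k := by
  refine lt_of_le_of_ne (formProd_nonneg A k) fun h0 => ?_
  obtain ⟨i, -, hi⟩ := Finset.prod_eq_zero_iff.1 h0.symm
  obtain ⟨j₀, hj₀⟩ := Function.ne_iff.1 hk
  have hinj : Function.Injective (fun l : ℕ => ((l : ℤ) + 2) • k) := by
    intro l l' h
    have h1 := congrFun h j₀
    simp only [Pi.smul_apply, smul_eq_mul] at h1
    have h2 := mul_right_cancel₀ hj₀ h1
    omega
  refine Set.infinite_of_injective_forall_mem hinj (fun l => ?_) hfin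
  constructor
  · intro h
    have h1 := h j₀
    have h2 : 1 ≤ |k j₀| := Int.one_le_abs hj₀
    rw [Pi.smul_apply, smul_eq_mul, abs_mul, abs_of_nonneg (by omega : (0 : ℤ) ≤ l + 2)] at h1
    nlinarith
  · have hz : formProd A (((l : ℤ) + 2) • k) = 0 := by
      refine Finset.prod_eq_zero (Finset.mem_univ i) ?_
      refine le_antisymm ?_ (distNearestInt_nonneg _)
      refine (distNearestInt_le_abs_sub_intCast _
        (((l : ℤ) + 2) * round (∑ j, A i j * (k j : ℝ)))).trans_eq ?_
      have h1 : ∑ j, A i j * (k j : ℝ) = round (∑ j, A i j * (k j : ℝ)) :=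
        sub_eq_zero.1 (abs_eq_zero.1 hi)
      have h2 : ∑ j, A i j * (((((l : ℤ) + 2) • k) j : ℤ) : ℝ) =
          ((l : ℝ) + 2) * ∑ j, A i j * (k j : ℝ) := by
        rw [Finset.mul_sum]
        refine Finset.sum_congr rfl fun j _ => ?_
        simp only [Pi.smul_apply, smul_eq_mul]
        push_cast
        ring
      rw [h2, abs_eq_zero, sub_eq_zero]
      push_cast
      rw [← h1]
    rw [hz]
    have : 0 ≤ intSupNorm (((l : ℤ) + 2) • k) := norm_nonneg _
    by_cases h1 : 1 ≤ intSupNorm (((l : ℤ) + 2) • k)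
    · have := Real.log_nonneg h1
      positivity
    · exfalso
      have h2 := ((intSupNorm_le_iff zero_le_one).1 (not_le.1 h1).le) j₀
      have h3 : |(((l : ℤ) + 2) • k) j₀| ≤ 1 := by exact_mod_cast h2
      have h4 : 1 ≤ |k j₀| := Int.one_le_abs hj₀
      rw [Pi.smul_apply, smul_eq_mul, abs_mul, abs_of_nonneg (by omega : (0 : ℤ) ≤ l + 2)] at h3
      nlinarith

theorem exists_pos_le_formProd {d n : ℕ} {A : Matrix (Fin d) (Fin n) ℝ} {E σ : ℝ}
    (hE : 0 < E) (hσ : 0 < σ)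
    (hfin : {q : Fin n → ℤ | ¬ (∀ j, |q j| ≤ 1) ∧
      formProd A q ≤ intSupNorm q ^ (-E) * Real.log (intSupNorm q) ^ σ}.Finite) :
    ∃ c : ℝ, 0 < c ∧ ∀ T : ℝ, 1 ≤ T → ∀ k : Fin n → ℤ, k ≠ 0 → (∀ j, |(k j : ℝ)| ≤ T) →
      c * (T ^ (-E) * (1 + Real.log T) ^ σ) ≤ formProd A k := by
  classical
  obtain ⟨C, hC, hClog⟩ := one_add_log_rpow_le hσ hE
  have hCT : ∀ u : ℝ, 1 ≤ u → u ^ (-E) * (1 + Real.log u) ^ σ ≤ C := by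
    intro u hu
    have hu0 : 0 < u := by linarith
    rw [Real.rpow_neg hu0.le, inv_mul_le_iff₀ (by positivity), mul_comm]
    exact hClog u hu
  set X := (hfin.toFinset ∪ intBox n 1).filter (· ≠ 0) with hX
  have hpos : ∀ k ∈ X, 0 < formProd A k := fun k hk =>
    formProd_pos_of_finite hfin (Finset.mem_filter.1 hk).2
  obtain ⟨c₀, hc₀, hc₀X⟩ : ∃ c₀ : ℝ, 0 < c₀ ∧ ∀ k ∈ X, c₀ ≤ formProd A k := by
    rcases X.eq_empty_or_nonempty with h | h
    · exact ⟨1, one_pos, by simp [h]⟩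
    · obtain ⟨k₀, hk₀, hmin⟩ := X.exists_min_image (formProd A) h
      exact ⟨_, hpos k₀ hk₀, hmin⟩
  have h3 : (0 : ℝ) < (1 / 3) ^ σ := by positivity
  refine ⟨min (c₀ / C) ((1 / 3) ^ σ / C), by positivity, fun T hT k hk hkT => ?_⟩
  have hT0 : 0 < T := by linarith
  have hlogT := Real.log_nonneg hT
  have hg0 : 0 ≤ T ^ (-E) * (1 + Real.log T) ^ σ := by positivity
  by_cases hkX : k ∈ X
  · calc _ ≤ c₀ / C * C := mul_le_mul (min_le_left _ _) (hCT T hT) hg0 (by positivity)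
      _ = c₀ := by field_simp
      _ ≤ _ := hc₀X k hkX
  · rw [hX, Finset.mem_filter, Finset.mem_union, Set.Finite.mem_toFinset, mem_intBox] at hkX
    have hk1 : ¬ ∀ j, |k j| ≤ 1 := fun h => hkX ⟨Or.inr fun j => by exact_mod_cast h j, hk⟩
    have hk2 : intSupNorm k ^ (-E) * Real.log (intSupNorm k) ^ σ < formProd A k := by
      by_contra h
      exact hkX ⟨Or.inl ⟨hk1, not_lt.1 h⟩, hk⟩
    set t := intSupNorm k with ht
    have ht2 : 2 ≤ t := by
      obtain ⟨j, hj⟩ := not_forall.1 hk1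
      have h1 : (2 : ℤ) ≤ |k j| := by omega
      have h2 : |(k j : ℝ)| ≤ t := (intSupNorm_le_iff (norm_nonneg _)).1 le_rfl j
      have h4 : (2 : ℝ) ≤ |(k j : ℝ)| := by exact_mod_cast h1
      linarith
    have htT : t ≤ T := (intSupNorm_le_iff hT0.le).2 hkT
    have hlogt : 1 / 2 ≤ Real.log t := by
      have := Real.log_le_log (by norm_num) ht2
      have := Real.log_two_gt_d9
      linarith
    have ht0 : 0 < t := by linarith
    have hu : 1 ≤ T / t := (one_le_div ht0).2 htT
    have hu0 : 0 < T / t := by linarith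
    have hTtu : T = t * (T / t) := by field_simp
    have h5 : T ^ (-E) * (1 + Real.log T) ^ σ ≤
        (t ^ (-E) * (1 + Real.log t) ^ σ) * C := by
      have hlu := Real.log_nonneg hu
      have h6 : (1 + Real.log T) ^ σ ≤ (1 + Real.log t) ^ σ * (1 + Real.log (T / t)) ^ σ := by
        rw [← Real.mul_rpow (by linarith) (by linarith)]
        refine Real.rpow_le_rpow (by linarith) ?_ hσ.le
        nth_rewrite 1 [hTtu]
        exact one_add_log_mul_le (by linarith) hu
      calc T ^ (-E) * (1 + Real.log T) ^ σ
          ≤ T ^ (-E) * ((1 + Real.log t) ^ σ * (1 + Real.log (T / t)) ^ σ) := by gcongr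
        _ = (t ^ (-E) * (1 + Real.log t) ^ σ) *
            ((T / t) ^ (-E) * (1 + Real.log (T / t)) ^ σ) := by
          nth_rewrite 1 [hTtu]
          rw [Real.mul_rpow ht0.le hu0.le]
          ring
        _ ≤ _ := by
          gcongr
          exact hCT _ hu
    have h7 : (1 / 3 : ℝ) ^ σ * (1 + Real.log t) ^ σ ≤ Real.log t ^ σ := by
      rw [← Real.mul_rpow (by norm_num) (by linarith)]
      exact Real.rpow_le_rpow (by linarith) (by linarith) hσ.le
    calc _ ≤ (1 / 3) ^ σ / C * ((t ^ (-E) * (1 + Real.log t) ^ σ) * C) :=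
          mul_le_mul (min_le_right _ _) h5 hg0 (by positivity)
      _ = t ^ (-E) * ((1 / 3) ^ σ * (1 + Real.log t) ^ σ) := by field_simp
      _ ≤ t ^ (-E) * Real.log t ^ σ := by gcongr
      _ ≤ _ := hk2.le

/-- The sum of the reciprocals of `∏ ‖A_i · k‖` for a matrix `A` satisfying a multiplicative
Diophantine condition. -/
theorem exists_recipSum_le {d n : ℕ} (hd : 1 ≤ d) (hn : 1 ≤ n) {A : Matrix (Fin d) (Fin n) ℝ}
    {E σ : ℝ} (hE : (n : ℝ) + 1 ≤ E) (hσ : 0 < σ)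
    (hfin : {q : Fin n → ℤ | ¬ (∀ j, |q j| ≤ 1) ∧
      formProd A q ≤ intSupNorm q ^ (-E) * Real.log (intSupNorm q) ^ σ}.Finite) :
    ∃ C : ℝ, 0 < C ∧ ∀ K : ℝ, 1 ≤ K →
      recipSum A K ≤ C * (K ^ E * (1 + Real.log K) ^ ((d : ℝ) - 1 - σ)) := by
  have hn0 : (0 : ℝ) ≤ n := Nat.cast_nonneg n
  have hE0 : 0 < E := by linarith
  obtain ⟨c, hc, hcA⟩ := exists_pos_le_formProd hE0 hσ hfin
  set η : ℝ := E - ((n : ℝ) + 1 / 2) with hη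
  obtain ⟨C₁, hC₁, hC₁log⟩ := one_add_log_rpow_le hσ (by linarith : 0 < η)
  obtain ⟨C₂, hC₂, hC₂A⟩ := recipSum_le (d := d) (n := n) hd
  set c' := c / C₁ with hc'
  have hc'0 : 0 < c' := by positivity
  have hlog2 : 0 < Real.log 2 := Real.log_pos (by norm_num)
  set D : ℝ := 1 + (|Real.log c'| + E) / Real.log 2 with hD
  have hD0 : 0 < D := by positivity
  refine ⟨C₂ * D ^ (d - 1) / c', by positivity, fun K hK => ?_⟩
  have hK0 : 0 < K := by linarith
  have hlogK := Real.log_nonneg hK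
  set Δ : ℝ := c' * (K ^ (-E) * (1 + Real.log K) ^ σ) with hΔ
  have hΔ0 : 0 < Δ := by positivity
  have hA : ∀ r : ℝ, 1 ≤ r → ∀ k : Fin n → ℤ, k ≠ 0 → (∀ j, |(k j : ℝ)| ≤ K / r) →
      Δ * r ^ ((n : ℝ) + 1 / 2) ≤ formProd A k := by
    intro r hr k hk hkb
    have hr0 : 0 < r := by linarith
    have hlogr := Real.log_nonneg hr
    have hT : 1 ≤ K / r := by
      obtain ⟨j, hj⟩ := Function.ne_iff.1 hk
      have h1 : (1 : ℝ) ≤ |(k j : ℝ)| := by exact_mod_cast Int.one_le_abs hj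
      exact h1.trans (hkb j)
    have hlogT := Real.log_nonneg hT
    have hKT : K = K / r * r := by field_simp
    refine le_trans ?_ (hcA (K / r) hT k hk hkb)
    have h6 : (1 + Real.log K) ^ σ ≤ (1 + Real.log (K / r)) ^ σ * (C₁ * r ^ η) := by
      calc (1 + Real.log K) ^ σ ≤ ((1 + Real.log (K / r)) * (1 + Real.log r)) ^ σ := by
            refine Real.rpow_le_rpow (by linarith) ?_ hσ.le
            nth_rewrite 1 [hKT]
            exact one_add_log_mul_le hT hr
        _ = (1 + Real.log (K / r)) ^ σ * (1 + Real.log r) ^ σ :=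
            Real.mul_rpow (by linarith) (by linarith)
        _ ≤ _ := by
            gcongr
            exact hC₁log r hr
    have h7 : r ^ η * r ^ ((n : ℝ) + 1 / 2) = r ^ E := by
      rw [← Real.rpow_add hr0]
      congr 1
      rw [hη]
      ring
    have h8 : (K / r) ^ (-E) = K ^ (-E) * r ^ E := by
      rw [Real.div_rpow hK0.le hr0.le, Real.rpow_neg hr0.le, div_inv_eq_mul]
    calc Δ * r ^ ((n : ℝ) + 1 / 2)
        ≤ c' * (K ^ (-E) * ((1 + Real.log (K / r)) ^ σ * (C₁ * r ^ η))) *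
          r ^ ((n : ℝ) + 1 / 2) := by
          rw [hΔ]
          gcongr
      _ = c' * C₁ * (K ^ (-E) * (r ^ η * r ^ ((n : ℝ) + 1 / 2)) * (1 + Real.log (K / r)) ^ σ) := by
          ring
      _ = _ := by
          rw [h7, h8, hc']
          field_simp
  have hΔ1 : Δ ≤ 1 := by
    have h1 := hA 1 le_rfl (fun _ => 1) (Function.ne_iff.2 ⟨⟨0, hn⟩, one_ne_zero⟩)
      (fun j => by simpa using hK)
    rw [Real.one_rpow, mul_one] at h1
    exact h1.trans (formProd_le_one _ _)
  obtain ⟨J, hJ, hJ'⟩ := exists_nat_pow_near ((one_le_div hΔ0).2 hΔ1) (by norm_num : (1 : ℝ) < 2)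
  have hJD : (J : ℝ) + 1 ≤ D * (1 + Real.log K) := by
    have h1 : (J : ℝ) * Real.log 2 ≤ |Real.log c'| + E * Real.log K := by
      have h2 := Real.log_le_log (by positivity) hJ
      have h3 : 1 ≤ (1 + Real.log K) ^ σ := Real.one_le_rpow (by linarith) hσ.le
      have h4 : 0 ≤ Real.log ((1 + Real.log K) ^ σ) := Real.log_nonneg h3
      rw [Real.log_pow, one_div, Real.log_inv, hΔ, Real.log_mul hc'0.ne' (by positivity),
        Real.log_mul (by positivity) (by positivity), Real.log_rpow hK0] at h2
      have := neg_abs_le (Real.log c')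
      linarith
    have h5 : (J : ℝ) ≤ (|Real.log c'| + E * Real.log K) / Real.log 2 := by
      rwa [le_div_iff₀ hlog2]
    have h6 : (|Real.log c'| + E * Real.log K) / Real.log 2 ≤
        (|Real.log c'| + E) / Real.log 2 * (1 + Real.log K) := by
      rw [div_mul_eq_mul_div]
      gcongr
      nlinarith [abs_nonneg (Real.log c')]
    rw [hD, add_mul]
    linarith
  calc recipSum A K ≤ C₂ * ((J : ℝ) + 1) ^ (d - 1) / Δ := hC₂A A Δ K hΔ0 hK0 hA J hJ hJ'
    _ ≤ C₂ * (D * (1 + Real.log K)) ^ (d - 1) / Δ := by gcongr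
    _ = _ := by
        have h1 : (1 + Real.log K) ^ ((d : ℝ) - 1 - σ) =
            (1 + Real.log K) ^ (d - 1) / (1 + Real.log K) ^ σ := by
          rw [Real.rpow_sub (by positivity), ← Real.rpow_natCast, Nat.cast_sub hd, Nat.cast_one]
        rw [h1, hΔ, mul_pow, Real.rpow_neg hK0.le]
        field_simp

/-- The radius `(q (1 + log q)^(1 + δ))^(1/N)`, whose inverse `N`-th powers form a convergent
series. -/
noncomputable def cutoff (N : ℕ) (δ : ℝ) (q : ℕ) : ℝ :=
  ((q : ℝ) * (1 + Real.log q) ^ (1 + δ)) ^ (1 / (N : ℝ))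

theorem cutoff_pos (N : ℕ) (δ : ℝ) {q : ℕ} (hq : 0 < q) : 0 < cutoff N δ q := by
  have hq1 : (1 : ℝ) ≤ q := by exact_mod_cast hq
  have := Real.log_nonneg hq1
  unfold cutoff
  positivity

theorem one_le_cutoff (N : ℕ) {δ : ℝ} (hδ : 0 < δ) {q : ℕ} (hq : 0 < q) : 1 ≤ cutoff N δ q := by
  have hq1 : (1 : ℝ) ≤ q := by exact_mod_cast hq
  have h := Real.log_nonneg hq1
  refine Real.one_le_rpow (one_le_mul_of_one_le_of_one_le hq1 ?_) (by positivity)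
  exact Real.one_le_rpow (by linarith) (by linarith)

theorem cutoff_pow {N : ℕ} (hN : 0 < N) (δ : ℝ) (q : ℕ) :
    cutoff N δ q ^ N = (q : ℝ) * (1 + Real.log q) ^ (1 + δ) := by
  have h : 0 ≤ Real.log (q : ℝ) := Real.log_natCast_nonneg q
  rw [cutoff, ← Real.rpow_natCast, ← Real.rpow_mul (by positivity), one_div_mul_cancel
    (by positivity), Real.rpow_one]

theorem summable_inv_mul_one_add_log_rpow {δ : ℝ} (hδ : 0 < δ) :
    Summable fun q : ℕ => ((q : ℝ) * (1 + Real.log q) ^ (1 + δ))⁻¹ := by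
  have hlog : ∀ q : ℕ, 0 ≤ Real.log (q : ℝ) := fun q => Real.log_natCast_nonneg q
  rw [← summable_condensed_iff_of_nonneg]
  · have hlog2 : 0 < Real.log 2 := Real.log_pos (by norm_num)
    have hs : Summable fun k : ℕ => (Real.log 2 ^ (1 + δ))⁻¹ * (((k + 1 : ℕ) : ℝ) ^ (1 + δ))⁻¹ :=
      ((summable_nat_add_iff 1).2 (Real.summable_nat_rpow_inv.2 (by linarith))).mul_left _
    refine Summable.of_nonneg_of_le (fun k => ?_) (fun k => ?_) hs
    · have := hlog (2 ^ k)
      positivity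
    · push_cast
      rw [Real.log_pow, mul_inv, mul_inv_cancel_left₀ (by positivity), ← mul_inv,
        ← Real.mul_rpow (by positivity) (by positivity)]
      have h1 : Real.log 2 ≤ 1 := by linarith [Real.log_two_lt_d9]
      refine inv_anti₀ (by positivity) (Real.rpow_le_rpow (by positivity) ?_ (by linarith))
      linarith
  · intro q
    have := hlog q
    positivity
  · intro m q hm hmq
    have hm' : (0 : ℝ) < m := by exact_mod_cast hm
    have hmq' : (m : ℝ) ≤ q := by exact_mod_cast hmq
    have := hlog m
    have h2 := Real.log_le_log hm' hmq'
    refine inv_anti₀ (by positivity) ?_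
    gcongr

theorem exists_recipSum_cutoff_le {d n N : ℕ} (hd : 1 ≤ d) (hN : 0 < N)
    {A : Matrix (Fin d) (Fin n) ℝ} {δ C : ℝ} (hδ : 0 < δ) (hC : 0 < C)
    (hA : ∀ K : ℝ, 1 ≤ K →
      recipSum A K ≤ C * (K ^ ((N : ℝ) * d) * (1 + Real.log K) ^ (-((d : ℝ) * (1 + δ))))) :
    ∃ C' : ℝ, 0 < C' ∧ ∀ q : ℕ, 0 < q → recipSum A (cutoff N δ q) ≤ C' * (q : ℝ) ^ d := by
  have hN' : (0 : ℝ) < N := by exact_mod_cast hN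
  refine ⟨C * (N : ℝ) ^ ((d : ℝ) * (1 + δ)), by positivity, fun q hq => ?_⟩
  have hq0 : (0 : ℝ) < q := by exact_mod_cast hq
  have hlog : 0 ≤ Real.log (q : ℝ) := Real.log_natCast_nonneg q
  have hK := one_le_cutoff N hδ hq
  have hK0 := cutoff_pos N δ hq
  refine (hA _ hK).trans ?_
  have h1 : cutoff N δ q ^ ((N : ℝ) * d) =
      (q : ℝ) ^ d * (1 + Real.log q) ^ ((d : ℝ) * (1 + δ)) := by
    rw [Real.rpow_mul hK0.le, Real.rpow_natCast, Real.rpow_natCast, cutoff_pow hN, mul_pow,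
      mul_comm (d : ℝ) (1 + δ), Real.rpow_mul (by linarith), Real.rpow_natCast]
  have h2 : (1 + Real.log q) / N ≤ 1 + Real.log (cutoff N δ q) := by
    have h3 : 1 ≤ (1 + Real.log (q : ℝ)) ^ (1 + δ) := Real.one_le_rpow (by linarith) (by linarith)
    have h4 : Real.log q / N ≤ Real.log (cutoff N δ q) := by
      rw [cutoff, Real.log_rpow (by positivity), Real.log_mul hq0.ne' (by positivity),
        div_eq_mul_one_div, mul_comm]
      gcongr
      linarith [Real.log_nonneg h3]
    have h5 : 1 / (N : ℝ) ≤ 1 := by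
      rw [div_le_one hN']
      exact_mod_cast hN
    rw [add_div]
    linarith
  have h6 : (1 + Real.log (cutoff N δ q)) ^ (-((d : ℝ) * (1 + δ))) ≤
      (N : ℝ) ^ ((d : ℝ) * (1 + δ)) * ((1 + Real.log q) ^ ((d : ℝ) * (1 + δ)))⁻¹ := by
    calc _ ≤ ((1 + Real.log q) / N) ^ (-((d : ℝ) * (1 + δ))) :=
          Real.rpow_le_rpow_of_nonpos (by positivity) h2 (by
            have : 0 ≤ (d : ℝ) * (1 + δ) := by positivity
            linarith)
      _ = _ := by
          rw [Real.rpow_neg (by positivity), Real.div_rpow (by linarith) hN'.le, inv_div,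
            div_eq_mul_inv]
  rw [h1]
  calc _ ≤ C * ((q : ℝ) ^ d * (1 + Real.log q) ^ ((d : ℝ) * (1 + δ)) *
        ((N : ℝ) ^ ((d : ℝ) * (1 + δ)) * ((1 + Real.log q) ^ ((d : ℝ) * (1 + δ)))⁻¹)) := by
        gcongr
    _ = _ := by
        have : (1 + Real.log (q : ℝ)) ^ ((d : ℝ) * (1 + δ)) ≠ 0 := by positivity
        field_simp

/-- The points `x` of the unit cube such that the first `d` coordinates of `q (x, α₀ + xA)` and
the remaining ones are all within `ρ` of an integer. -/
def nearSet {d n : ℕ} (A : Matrix (Fin d) (Fin n) ℝ) (α₀ : Fin n → ℝ) (q : ℕ) (ρ : ℝ) :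
    Set (Fin d → ℝ) :=
  {x | (∀ i, x i ∈ Set.Icc (0 : ℝ) 1) ∧ (∀ i, distNearestInt (q * x i) < ρ) ∧
    ∀ j, distNearestInt (q * (α₀ j + ∑ i, x i * A i j)) < ρ}

theorem sum_abs_le_sum_sum_abs {d n : ℕ} (A : Matrix (Fin d) (Fin n) ℝ) (j : Fin n) :
    ∑ i, |A i j| ≤ ∑ j, ∑ i, |A i j| :=
  Finset.single_le_sum (f := fun j => ∑ i, |A i j|)
    (fun _ _ => Finset.sum_nonneg fun _ _ => abs_nonneg _) (Finset.mem_univ j)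

theorem exists_round_of_mem_nearSet {d n : ℕ} {A : Matrix (Fin d) (Fin n) ℝ} {α₀ : Fin n → ℝ}
    {q : ℕ} {ρ : ℝ} (hρ : 0 < ρ) {x : Fin d → ℝ} (hx : x ∈ nearSet A α₀ q ρ) :
    ∃ a : Fin d → ℕ, (∀ i, a i ∈ Finset.range (q + 1)) ∧ (∀ i, |q * x i - a i| < ρ) ∧
      ∀ j, distNearestInt (q * α₀ j + ∑ i, (a i : ℝ) * A i j) ≤
        (1 + ∑ j, ∑ i, |A i j|) * ρ := by
  obtain ⟨hx1, hx2, hx3⟩ := hx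
  have hround : ∀ i, 0 ≤ round (q * x i) ∧ round (q * x i) ≤ q := by
    intro i
    have h1 := abs_le.1 (abs_sub_round (q * x i))
    have h2 := hx1 i
    have hq0 : (0 : ℝ) ≤ q := Nat.cast_nonneg q
    have h3 : 0 ≤ q * x i := mul_nonneg hq0 h2.1
    have h4 : q * x i ≤ q := mul_le_of_le_one_right hq0 h2.2
    constructor
    · have : (-1 : ℝ) < round (q * x i) := by linarith
      have : (-1 : ℤ) < round (q * x i) := by exact_mod_cast this
      omega
    · have : (round (q * x i) : ℝ) < q + 1 := by linarith
      have : round (q * x i) < q + 1 := by exact_mod_cast this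
      omega
  have hcast : ∀ i, (((round (q * x i)).toNat : ℕ) : ℝ) = (round (q * x i) : ℤ) := by
    intro i
    rw [← Int.cast_natCast, Int.toNat_of_nonneg (hround i).1]
  have hlt : ∀ i, |q * x i - ((round (q * x i)).toNat : ℕ)| < ρ := by
    intro i
    rw [hcast]
    exact hx2 i
  refine ⟨fun i => (round (q * x i)).toNat, fun i => ?_, hlt, fun j => ?_⟩
  · have := hround i
    rw [Finset.mem_range]
    beta_reduce
    omega
  · refine (distNearestInt_le_add_abs_sub _ (q * (α₀ j + ∑ i, x i * A i j))).trans ?_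
    have e : q * α₀ j + ∑ i, (((round (q * x i)).toNat : ℕ) : ℝ) * A i j -
        q * (α₀ j + ∑ i, x i * A i j) =
        ∑ i, -(q * x i - ((round (q * x i)).toNat : ℕ)) * A i j := by
      rw [mul_add, Finset.mul_sum, add_sub_add_left_eq_sub, ← Finset.sum_sub_distrib]
      exact Finset.sum_congr rfl fun i _ => by ring
    rw [e]
    have h1 : |∑ i, -(q * x i - ((round (q * x i)).toNat : ℕ)) * A i j| ≤
        ρ * ∑ j, ∑ i, |A i j| := by
      calc _ ≤ ∑ i, |-(q * x i - ((round (q * x i)).toNat : ℕ)) * A i j| :=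
            Finset.abs_sum_le_sum_abs _ _
        _ ≤ ∑ i, ρ * |A i j| := by
            refine Finset.sum_le_sum fun i _ => ?_
            rw [abs_mul, abs_neg]
            exact mul_le_mul_of_nonneg_right (hlt i).le (abs_nonneg _)
        _ = ρ * ∑ i, |A i j| := by rw [Finset.mul_sum]
        _ ≤ _ := mul_le_mul_of_nonneg_left (sum_abs_le_sum_sum_abs A j) hρ.le
    have h2 := (hx3 j).le
    rw [add_mul, one_mul, mul_comm _ ρ]
    exact add_le_add h2 h1

open MeasureTheory in
theorem exists_volume_nearSet_le {d n : ℕ} (A : Matrix (Fin d) (Fin n) ℝ) (α₀ : Fin n → ℝ)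
    (hA : ∀ k, k ≠ 0 → 0 < formProd A k) {C : ℝ} (hC : 0 < C) :
    ∃ C' : ℝ, ∀ (q : ℕ) (ρ K : ℝ), 0 < q → 0 < ρ → 1 / ρ ≤ K →
      recipSum A K ≤ C * (q : ℝ) ^ d →
      volume (nearSet A α₀ q ρ) ≤ ENNReal.ofReal (C' * ρ ^ (d + n)) := by
  classical
  set B : ℝ := 1 + ∑ j, ∑ i, |A i j| with hB
  have hB1 : 1 ≤ B := by
    have : 0 ≤ ∑ j, ∑ i, |A i j| :=
      Finset.sum_nonneg fun _ _ => Finset.sum_nonneg fun _ _ => abs_nonneg _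
    linarith
  have hB0 : 0 < B := by linarith
  set C₁ : ℝ := (6 * B) ^ (d + n) with hC₁
  set C₂ : ℝ := 4 ^ n * (12 * B) ^ n * (2 ^ d + C) * 2 ^ d with hC₂
  refine ⟨max C₁ C₂, fun q ρ K hq hρ hρK hK => ?_⟩
  have hq0 : (0 : ℝ) < q := by exact_mod_cast hq
  by_cases hbig : 1 < 6 * B * ρ
  · have hsub : nearSet A α₀ q ρ ⊆ Set.Icc 0 1 := fun x hx =>
      ⟨fun i => (hx.1 i).1, fun i => (hx.1 i).2⟩
    calc volume (nearSet A α₀ q ρ) ≤ volume (Set.Icc (0 : Fin d → ℝ) 1) := measure_mono hsub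
      _ = ENNReal.ofReal 1 := by rw [Real.volume_Icc_pi]; simp
      _ ≤ _ := by
        refine ENNReal.ofReal_le_ofReal ?_
        calc (1 : ℝ) ≤ (6 * B * ρ) ^ (d + n) := one_le_pow₀ hbig.le
          _ = C₁ * ρ ^ (d + n) := by rw [mul_pow]
          _ ≤ _ := by
            gcongr
            exact le_max_left _ _
  rw [not_lt] at hbig
  set y : ℝ := 1 / (6 * B * ρ) with hy
  have hy0 : 0 < y := by positivity
  have hy1 : 1 ≤ y := (one_le_div (by positivity)).2 hbig
  set H := ⌊y⌋₊ with hH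
  have hHpos : 0 < H := Nat.floor_pos.2 hy1
  have hH0 : (0 : ℝ) < H := by exact_mod_cast hHpos
  have hHy : (H : ℝ) ≤ y := Nat.floor_le hy0.le
  have hyH : y ≤ 2 * H := by
    have h1 := Nat.lt_floor_add_one y
    have h2 : (1 : ℝ) ≤ H := by exact_mod_cast hHpos
    linarith
  have hHK : (H : ℝ) ≤ K := by
    refine (hHy.trans ?_).trans hρK
    refine one_div_le_one_div_of_le hρ ?_
    nlinarith
  have hBρ : B * ρ ≤ 1 / (6 * H) := by
    rw [le_div_iff₀ (by positivity)]
    have h1 : (H : ℝ) * (6 * B * ρ) ≤ 1 := by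
      rwa [hy, le_div_iff₀ (by positivity)] at hHy
    linarith
  have hHinv : 1 / (H : ℝ) ≤ 12 * B * ρ := by
    rw [div_le_iff₀ hH0]
    rw [hy, div_le_iff₀ (by positivity)] at hyH
    linarith
  set G := (Fintype.piFinset (fun _ : Fin d => Finset.range (q + 1))).filter
      (fun a => ∀ j, distNearestInt (q * α₀ j + ∑ i, (a i : ℝ) * A i j) ≤ 1 / (6 * H)) with hG
  have hGcard : (G.card : ℝ) ≤ 4 ^ n * (12 * B * ρ) ^ n * ((2 ^ d + C) * (q : ℝ) ^ d) := by
    refine (card_filter_near_le (fun j => q * α₀ j) hA (q + 1) hHpos).trans ?_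
    have h1 : (((q + 1 : ℕ) : ℝ)) ^ d ≤ 2 ^ d * (q : ℝ) ^ d := by
      rw [← mul_pow]
      have : (1 : ℝ) ≤ q := by exact_mod_cast hq
      push_cast
      gcongr
      linarith
    have h2 := (recipSum_mono A hHK).trans hK
    have h3 : 0 ≤ recipSum A H :=
      Finset.sum_nonneg fun k _ => inv_nonneg.2 (formProd_nonneg A k)
    have h4 : (4 : ℝ) ^ n / H ^ n ≤ 4 ^ n * (12 * B * ρ) ^ n := by
      rw [div_eq_mul_one_div, ← one_div_pow]
      gcongr
    refine mul_le_mul h4 ?_ (by positivity) (by positivity)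
    linarith
  have hcover : nearSet A α₀ q ρ ⊆ ⋃ a ∈ G, Metric.ball (fun i => (a i : ℝ) / q) (ρ / q) := by
    intro x hx
    obtain ⟨a, ha1, ha2, ha3⟩ := exists_round_of_mem_nearSet hρ hx
    refine Set.mem_iUnion₂.2 ⟨a, ?_, ?_⟩
    · rw [hG, Finset.mem_filter, Fintype.mem_piFinset]
      exact ⟨ha1, fun j => (ha3 j).trans hBρ⟩
    · rw [Metric.mem_ball, dist_pi_lt_iff (by positivity)]
      intro i
      rw [Real.dist_eq, lt_div_iff₀ hq0]
      calc |x i - a i / q| * q = |(x i - a i / q) * q| := by rw [abs_mul, abs_of_pos hq0]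
        _ = |q * x i - a i| := by
          congr 1
          field_simp
        _ < ρ := ha2 i
  calc volume (nearSet A α₀ q ρ)
      ≤ ∑ a ∈ G, volume (Metric.ball (fun i => (a i : ℝ) / q) (ρ / q) : Set (Fin d → ℝ)) :=
        (measure_mono hcover).trans (measure_biUnion_finset_le _ _)
    _ = ENNReal.ofReal (G.card * (2 * (ρ / q)) ^ d) := by
        simp_rw [Real.volume_pi_ball _ (by positivity : 0 < ρ / q)]
        rw [Finset.sum_const, nsmul_eq_mul, Fintype.card_fin,
          ENNReal.ofReal_mul (Nat.cast_nonneg _), ENNReal.ofReal_natCast]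
    _ ≤ _ := by
        refine ENNReal.ofReal_le_ofReal ?_
        calc (G.card : ℝ) * (2 * (ρ / q)) ^ d
            ≤ 4 ^ n * (12 * B * ρ) ^ n * ((2 ^ d + C) * (q : ℝ) ^ d) * (2 * (ρ / q)) ^ d := by
              gcongr
          _ = C₂ * ρ ^ (d + n) := by
              rw [hC₂, mul_pow (12 * B) ρ, mul_pow 2, div_pow, pow_add]
              field_simp
          _ ≤ _ := by
              gcongr
              exact le_max_right _ _

open MeasureTheory in
/-- Borel–Cantelli for the sets `nearSet`. -/
theorem volume_frequently_nearSet_eq_zero {d n : ℕ} (hd : 1 ≤ d)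
    {A : Matrix (Fin d) (Fin n) ℝ} (α₀ : Fin n → ℝ)
    (hA : ∀ k, k ≠ 0 → 0 < formProd A k) {δ C : ℝ} (hδ : 0 < δ) (hC : 0 < C)
    (hAC : ∀ q : ℕ, 0 < q → recipSum A (cutoff (d + n) δ q) ≤ C * (q : ℝ) ^ d)
    {ψ : ℕ → ℝ} (hψ0 : ∀ q, 0 < q → 0 < ψ q)
    (hψ : Summable fun q : ℕ => ψ (q + 1) ^ (d + n)) :
    volume {x | ∃ᶠ q in Filter.atTop, 0 < q ∧ x ∈ nearSet A α₀ q (ψ q)} = 0 := by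
  obtain ⟨C', hC'⟩ := exists_volume_nearSet_le A α₀ hA hC
  set N := d + n with hN
  have hN0 : 0 < N := by omega
  set φ : ℕ → ℝ := fun q => max (ψ q) (1 / cutoff N δ q) with hφ
  have hφle : ∀ q : ℕ, φ (q + 1) ^ N ≤
      ψ (q + 1) ^ N + (((q + 1 : ℕ) : ℝ) * (1 + Real.log (q + 1 : ℕ)) ^ (1 + δ))⁻¹ := by
    intro q
    have h1 : (1 / cutoff N δ (q + 1)) ^ N =
        (((q + 1 : ℕ) : ℝ) * (1 + Real.log (q + 1 : ℕ)) ^ (1 + δ))⁻¹ := by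
      rw [one_div, inv_pow, cutoff_pow hN0]
    have h2 : 0 < ψ (q + 1) ^ N := pow_pos (hψ0 _ q.succ_pos) N
    have h3 : 0 < (1 / cutoff N δ (q + 1)) ^ N := by
      have := cutoff_pos N δ q.succ_pos
      positivity
    rw [← h1]
    rcases max_choice (ψ (q + 1)) (1 / cutoff N δ (q + 1)) with h | h <;> simp only [hφ, h] <;>
      linarith
  have hφ0 : ∀ q, 0 < q → 0 < φ q := fun q hq => (hψ0 q hq).trans_le (le_max_left _ _)
  have hφsum : Summable fun q => C' * φ q ^ N := by
    refine Summable.mul_left _ ((summable_nat_add_iff 1).1 ?_)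
    exact Summable.of_nonneg_of_le (fun q => (pow_pos (hφ0 _ q.succ_pos) N).le) hφle
      (hψ.add ((summable_nat_add_iff 1).2 (summable_inv_mul_one_add_log_rpow hδ)))
  refine measure_setOfPred_frequently_eq_zero (ne_top_of_le_ne_top hφsum.tsum_ofReal_ne_top
    (ENNReal.tsum_le_tsum fun q => ?_))
  rcases Nat.eq_zero_or_pos q with rfl | hq
  · simp
  · have hK := cutoff_pos N δ hq
    refine (measure_mono ?_).trans (hC' q (φ q) (cutoff N δ q) hq (hφ0 q hq) ?_ (hAC q hq))
    · rintro x ⟨-, hx1, hx2, hx3⟩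
      exact ⟨hx1, fun i => (hx2 i).trans_le (le_max_left _ _),
        fun j => (hx3 j).trans_le (le_max_left _ _)⟩
    · rw [one_div_le (hφ0 q hq) hK]
      exact le_max_right _ _

/-- The parametrization `x ↦ (x, α₀ + xA)` of an affine subspace of `ℝ^N`. -/
noncomputable def affineParam {d N : ℕ} (A : Matrix (Fin d) (Fin (N - d)) ℝ)
    (α₀ : Fin (N - d) → ℝ) (x : Fin d → ℝ) : EuclideanSpace ℝ (Fin N) :=
  WithLp.toLp 2 fun i => if h : (i : ℕ) < d then x ⟨i, h⟩ else
    α₀ ⟨i - d, by have := i.isLt; omega⟩ +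
      ∑ l, x l * A l ⟨i - d, by have := i.isLt; omega⟩

theorem exists_lipschitzWith_affineParam {d N : ℕ} (A : Matrix (Fin d) (Fin (N - d)) ℝ)
    (α₀ : Fin (N - d) → ℝ) : ∃ L, LipschitzWith L (affineParam A α₀) := by
  have hB0 : 0 ≤ ∑ j, ∑ i, |A i j| :=
    Finset.sum_nonneg fun _ _ => Finset.sum_nonneg fun _ _ => abs_nonneg _
  refine ⟨_, (PiLp.lipschitzWith_toLp 2 (fun _ : Fin N => ℝ)).comp
    (LipschitzWith.of_dist_le_mul (K := (1 + ∑ j, ∑ i, |A i j|).toNNReal) fun x y => ?_)⟩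
  rw [Real.coe_toNNReal _ (by linarith), dist_pi_le_iff (by positivity)]
  intro i
  have hxy : ∀ l, |x l - y l| ≤ dist x y := fun l => dist_le_pi_dist x y l
  have hd0 : 0 ≤ dist x y := dist_nonneg
  split_ifs with h
  · rw [Real.dist_eq]
    refine (hxy _).trans ?_
    nlinarith
  · rw [Real.dist_eq, add_sub_add_left_eq_sub, ← Finset.sum_sub_distrib]
    set j : Fin (N - d) := ⟨i - d, by have := i.isLt; omega⟩
    calc |∑ l, (x l * A l j - y l * A l j)| ≤ ∑ l, |x l * A l j - y l * A l j| :=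
          Finset.abs_sum_le_sum_abs _ _
      _ ≤ ∑ l, dist x y * |A l j| := by
          refine Finset.sum_le_sum fun l _ => ?_
          rw [← sub_mul, abs_mul]
          exact mul_le_mul_of_nonneg_right (hxy l) (abs_nonneg _)
      _ = dist x y * ∑ l, |A l j| := by rw [Finset.mul_sum]
      _ ≤ dist x y * ∑ j, ∑ i, |A i j| :=
          mul_le_mul_of_nonneg_left (sum_abs_le_sum_sum_abs A j) hd0
      _ ≤ _ := by nlinarith

theorem vecMul_cons_one {d n : ℕ} (A : Matrix (Fin d) (Fin n) ℝ) (α₀ : Fin n → ℝ)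
    (x : Fin d → ℝ) (j : Fin n) :
    Matrix.vecMul (Fin.cons 1 x) (Matrix.of (Fin.cons α₀ (fun i => A i))) j =
      α₀ j + ∑ i, x i * A i j := by
  simp [Matrix.vecMul, dotProduct, Fin.sum_univ_succ]

theorem exists_finite_of_multLogExp_lt {d n : ℕ} {A : Matrix (Fin d) (Fin n) ℝ} {E s : ℝ}
    (h : multLogExp A E < (s : EReal)) :
    ∃ σ : ℝ, -s < σ ∧ {q : Fin n → ℤ | ¬ (∀ j, |q j| ≤ 1) ∧
      formProd A q ≤ intSupNorm q ^ (-E) * Real.log (intSupNorm q) ^ σ}.Finite := by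
  obtain ⟨γ, h1, h2⟩ := EReal.lt_iff_exists_real_btwn.1 h
  refine ⟨-γ, neg_lt_neg (EReal.coe_lt_coe_iff.1 h2), ?_⟩
  by_contra hinf
  exact h1.not_ge (le_sSup ⟨γ, hinf, rfl⟩)

open MeasureTheory in
/-- **Corollary 1.12 (ii)**: if `ω_m(A) = Nd` and `ω'_m(A, Nd) < 1 - 2d`, then the affine
subspace `ℋ = {(x, x̃Ã) : x ∈ [0,1]^d}` is of strong Khintchine type for convergence
(no monotonicity assumption on `ψ`). -/
theorem strong_khintchine_type_convergence (d N : ℕ) (hd : 1 ≤ d) (hdN : d < N)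
    (A : Matrix (Fin d) (Fin (N - d)) ℝ) (α₀ : Fin (N - d) → ℝ)
    (Atil : Matrix (Fin (d + 1)) (Fin (N - d)) ℝ)
    (hAtil : Atil = Matrix.of (Fin.cons α₀ (fun i => A i)))
    (hω : multExp A = (((N : ℝ) * (d : ℝ) : ℝ) : EReal))
    (hω' : multLogExp A ((N : ℝ) * (d : ℝ)) < ((1 - 2 * (d : ℝ) : ℝ) : EReal)) :
    ∀ ψ : ℝ → ℝ, (∀ x, 1 ≤ x → 0 < ψ x ∧ ψ x ≤ 1) →
      Summable (fun q : ℕ => ψ ((q : ℝ) + 1) ^ N) →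
      μH[(d : ℝ)] (simultApprox N ψ ∩
        {z : EuclideanSpace ℝ (Fin N) | ∃ x : Fin d → ℝ,
          (∀ i, x i ∈ Set.Icc (0 : ℝ) 1) ∧
          (∀ i : Fin N, (h : (i : ℕ) < d) → z i = x ⟨i, h⟩) ∧
          (∀ j : Fin (N - d), z ⟨d + (j : ℕ), by have := j.isLt; omega⟩ =
            Matrix.vecMul (Fin.cons 1 x) Atil j)}) = 0 := by
  intro ψ hψ hsum
  have hd0 : (1 : ℝ) ≤ d := by exact_mod_cast hd
  have hNcast : ((N - d : ℕ) : ℝ) = (N : ℝ) - d := Nat.cast_sub hdN.le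
  have hdN' : (d : ℝ) + 1 ≤ N := by exact_mod_cast hdN
  have hN : d + (N - d) = N := by omega
  obtain ⟨σ, hσ, hfin⟩ := exists_finite_of_multLogExp_lt hω'
  have hσ0 : 0 < σ := by linarith
  have hpos : ∀ k : Fin (N - d) → ℤ, k ≠ 0 → 0 < formProd A k :=
    fun k hk => formProd_pos_of_finite hfin hk
  obtain ⟨C, hC, hCK⟩ := exists_recipSum_le hd (by omega) (by rw [hNcast]; nlinarith) hσ0 hfin
  set δ : ℝ := (σ - (2 * d - 1)) / d with hδ
  have hδ0 : 0 < δ := div_pos (by linarith) (by linarith)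
  have hδσ : (d : ℝ) - 1 - σ = -((d : ℝ) * (1 + δ)) := by
    rw [hδ]
    field_simp
    ring
  rw [hδσ] at hCK
  obtain ⟨C', hC', hCq⟩ := exists_recipSum_cutoff_le hd (by omega : 0 < N) hδ0 hC hCK
  have hnull := volume_frequently_nearSet_eq_zero hd α₀ hpos hδ0 hC' (by rwa [hN])
    (ψ := fun q : ℕ => ψ q) (fun q hq => (hψ q (by exact_mod_cast hq)).1)
    (by simpa [hN] using hsum)
  obtain ⟨L, hL⟩ := exists_lipschitzWith_affineParam A α₀
  have himage := hL.hausdorffMeasure_image_le (d := (d : ℝ)) (by linarith)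
    {x | ∃ᶠ q in Filter.atTop, 0 < q ∧ x ∈ nearSet A α₀ q (ψ q)}
  have hvol : (μH[(d : ℝ)] : Measure (Fin d → ℝ)) = volume := by
    simpa using hausdorffMeasure_pi_real (ι := Fin d)
  rw [hvol, hnull, mul_zero, nonpos_iff_eq_zero] at himage
  refine measure_mono_null ?_ himage
  rintro z ⟨hz, x, hx, hzx, hzA⟩
  simp only [hAtil, vecMul_cons_one] at hzA
  refine ⟨x, ?_, ?_⟩
  · refine (Nat.frequently_atTop_iff_infinite.2 hz).mono ?_
    rintro q ⟨hq, hqz⟩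
    refine ⟨hq, hx, fun i => ?_, fun j => ?_⟩
    · have h := hqz ⟨i, i.isLt.trans hdN⟩
      rwa [hzx _ i.isLt] at h
    · have h := hqz ⟨d + (j : ℕ), by have := j.isLt; omega⟩
      rwa [hzA j] at h
  · ext i
    simp only [affineParam]
    split_ifs with h
    · exact (hzx i h).symm
    · rw [← hzA]
      have hi : (⟨d + ((i : ℕ) - d), by have := i.isLt; omega⟩ : Fin N) = i := Fin.ext (by
        simp only
        omega)
      exact congrArg z.ofLp hi
end

section
/- Let 1 ≤ d < N be integers, s ∈ [0,∞), and let A ∈ ℝ^{d×(N−d)} be φ-semi multiplicatively badly approximable, where φ : [1,∞) → (0,1] is non-increasing and satisfies: (i) for every λ ≥ 1 there is c_λ > 0 with φ(λx) ≥ c_λ φ(x) for all x ≥ 1; (ii) there exist γ > 0 and c₁, c₂ > 0 with c₁ x^{−γ} ≤ φ(x) for all x ≥ 1 and φ(x) ≤ c₂/log(x) for all x > 1; (iii) there exists a function ψ̂ : [1,∞) → (0,1] with Σ_{q=1}^∞ ψ̂(q)^{N−d+s} q^{d−s} < ∞ and a constant c₃ > 0 such that φ(1/ψ̂(x)) ·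 ψ̂(x)^{N−d} ≥ c₃ (log x)^{d−1} / x^d for all x ≥ 2. Then for every (not necessarily non-increasing) ψ : [1,∞) → (0,1] with Σ_{q=1}^∞ ψ(q)^{N−d+s} q^{d−s} < ∞, the s-dimensional Hausdorff measure of 𝒮_N(ψ) ∩ ℋ is 0, where ℋ := {(x, x̃Ã) : x ∈ [0,1]^d} ⊂ ℝ^N and Ã ∈ ℝ^{(d+1)×(N−d)} is the matrix with first row an arbitrary α₀ ∈ ℝ^{N−d} and remaining rows those of A. -/
open scoped BigOperators

/-- the character `x ↦ exp (2 π i x)` of `ℝ` -/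
noncomputable def unitExp (x : ℝ) : ℂ := Complex.exp (Complex.I * ((2 * Real.pi * x : ℝ) : ℂ))

lemma unitExp_add (x y : ℝ) : unitExp (x + y) = unitExp x * unitExp y := by
  simp only [unitExp, ← Complex.exp_add]
  congr 1
  push_cast
  ring

lemma unitExp_zero : unitExp 0 = 1 := by simp [unitExp]

lemma unitExp_sum {ι : Type*} (s : Finset ι) (f : ι → ℝ) :
    unitExp (∑ i ∈ s, f i) = ∏ i ∈ s, unitExp (f i) := by
  classical
  induction s using Finset.induction_on with
  | empty => simp [unitExp_zero]
  | insert a s ha ih => rw [Finset.sum_insert ha, Finset.prod_insert ha, unitExp_add, ih]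

lemma unitExp_nat_mul (n : ℕ) (x : ℝ) : unitExp (n * x) = unitExp x ^ n := by
  simp only [unitExp, ← Complex.exp_nat_mul]
  congr 1
  push_cast
  ring

lemma norm_unitExp (x : ℝ) : ‖unitExp x‖ = 1 := by
  rw [unitExp, mul_comm, Complex.norm_exp_ofReal_mul_I]

lemma conj_unitExp (x : ℝ) : (starRingEnd ℂ) (unitExp x) = unitExp (-x) := by
  rw [unitExp, unitExp, ← Complex.exp_conj, map_mul, Complex.conj_I, Complex.conj_ofReal]
  congr 1
  push_cast
  ring

lemma unitExp_add_int (x : ℝ) (n : ℤ) : unitExp (x + n) = unitExp x := by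
  rw [unitExp_add]
  have : unitExp n = 1 := by
    rw [unitExp, ← Complex.exp_int_mul_two_pi_mul_I n]
    congr 1
    push_cast
    ring
  rw [this, mul_one]

lemma re_unitExp (x : ℝ) : (unitExp x).re = Real.cos (2 * Real.pi * x) := by
  rw [unitExp, mul_comm, Complex.exp_ofReal_mul_I_re]

lemma half_le_re_unitExp {x : ℝ} (n : ℤ) (hx : |x - n| ≤ 1 / 6) : 1 / 2 ≤ (unitExp x).re := by
  have h : unitExp x = unitExp (x - n) := by
    rw [← unitExp_add_int (x - n) n]
    congr 1
    ring
  rw [h, re_unitExp, ← Real.cos_abs, ← Real.cos_pi_div_three]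
  have hpi := Real.pi_pos
  apply Real.cos_le_cos_of_nonneg_of_le_pi (abs_nonneg _) (by linarith)
  rw [abs_mul, abs_of_pos (by positivity)]
  nlinarith

lemma four_mul_distNearestInt_le (x : ℝ) : 4 * distNearestInt x ≤ ‖unitExp x - 1‖ := by
  have h : unitExp x = unitExp (x - round x) := by
    rw [← unitExp_add_int (x - round x) (round x)]
    congr 1
    ring
  rw [h, unitExp, Complex.norm_exp_I_mul_ofReal_sub_one, distNearestInt]
  have hy := abs_sub_round x
  set y := x - round x
  have hpi := Real.pi_pos
  have h1 : 2 * Real.pi * y / 2 = Real.pi * y := by ring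
  rw [h1, norm_mul, Real.norm_eq_abs, Real.norm_eq_abs, abs_of_pos (by norm_num : (0 : ℝ) < 2)]
  have h2 : 2 / Real.pi * (Real.pi * |y|) ≤ Real.sin (Real.pi * |y|) :=
    Real.mul_le_sin (by positivity) (by nlinarith)
  have h3 : 2 / Real.pi * (Real.pi * |y|) = 2 * |y| := by field_simp
  have h4 : Real.sin (Real.pi * |y|) ≤ |Real.sin (Real.pi * y)| := by
    rcases abs_cases y with ⟨e, _⟩ | ⟨e, _⟩
    · rw [e]; exact le_abs_self _
    · rw [e, mul_neg, Real.sin_neg]; exact neg_le_abs _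
  linarith

lemma norm_sum_unitExp_mul_le (n : ℕ) (x : ℝ) :
    ‖∑ a ∈ Finset.range n, unitExp (a * x)‖ * (2 * distNearestInt x) ≤ 1 := by
  have h1 : (∑ a ∈ Finset.range n, unitExp (a * x)) * (unitExp x - 1) = unitExp x ^ n - 1 := by
    rw [← geom_sum_mul]
    simp only [unitExp_nat_mul]
  have h2 : ‖unitExp x ^ n - 1‖ ≤ 2 := by
    refine (norm_sub_le _ _).trans ?_
    rw [norm_pow, norm_unitExp]
    norm_num
  rw [← h1, norm_mul] at h2
  have h3 := mul_le_mul_of_nonneg_left (four_mul_distNearestInt_le x)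
    (norm_nonneg (∑ a ∈ Finset.range n, unitExp (a * x)))
  linarith

lemma norm_sum_unitExp_le (n : ℕ) (x : ℝ) : ‖∑ a ∈ Finset.range n, unitExp (a * x)‖ ≤ n := by
  refine (norm_sum_le _ _).trans ?_
  simp [norm_unitExp]

lemma norm_sum_unitExp_neg (n : ℕ) (x : ℝ) :
    ‖∑ a ∈ Finset.range n, unitExp (-(a * x))‖ = ‖∑ a ∈ Finset.range n, unitExp (a * x)‖ := by
  rw [← Complex.norm_conj (∑ a ∈ Finset.range n, unitExp (a * x)), map_sum]
  simp only [conj_unitExp]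

/-- the index of the cell of side `η` containing the signed distance of `x` to the nearest
integer -/
noncomputable def cellIndex (η x : ℝ) : ℤ := ⌊(x - round x) / η⌋

lemma distNearestInt_sub_lt_of_cellIndex_eq {η x y : ℝ} (hη : 0 < η)
    (h : cellIndex η x = cellIndex η y) : distNearestInt (x - y) < η := by
  have h1 := Int.abs_sub_lt_one_of_floor_eq_floor h
  rw [← sub_div, abs_div, abs_of_pos hη, div_lt_one hη] at h1
  refine lt_of_le_of_lt (round_le _ (round x - round y)) ?_
  convert h1 using 2
  push_cast
  ring

lemma cellIndex_mul_le (η x : ℝ) (hη : 0 < η) :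
    η * (|(cellIndex η x : ℝ)| - 1) ≤ distNearestInt x := by
  have h1 : (cellIndex η x : ℝ) ≤ (x - round x) / η := Int.floor_le _
  have h2 : (x - round x) / η < cellIndex η x + 1 := Int.lt_floor_add_one _
  rw [distNearestInt]
  rw [le_div_iff₀ hη] at h1
  rw [div_lt_iff₀ hη] at h2
  set y := x - round x
  rcases abs_cases (cellIndex η x : ℝ) with ⟨e, _⟩ | ⟨e, _⟩ <;> rw [e]
  · have := le_abs_self y
    nlinarith
  · have := neg_le_abs y
    nlinarith

lemma kernel_bound {q : ℕ} {c : ℝ} (hc : 0 < c) (hc1 : c ≤ 1) (hq : 0 < q) (x : ℝ) :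
    ‖∑ a ∈ Finset.range (2 * q), unitExp (a * x)‖ * ‖∑ a ∈ Finset.range q, unitExp (a * x)‖ ≤
      8 * (q : ℝ) ^ 2 / c ^ 2 * (1 / (1 + (cellIndex (c / q) x : ℝ) ^ 2)) := by
  have hq' : (0 : ℝ) < q := by exact_mod_cast hq
  have a1 := norm_sum_unitExp_le (2 * q) x
  have a2 := norm_sum_unitExp_le q x
  have b1 := norm_sum_unitExp_mul_le (2 * q) x
  have b2 := norm_sum_unitExp_mul_le q x
  have n1 := norm_nonneg (∑ a ∈ Finset.range (2 * q), unitExp (a * x))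
  have n2 := norm_nonneg (∑ a ∈ Finset.range q, unitExp (a * x))
  have hj := cellIndex_mul_le (c / q) x (by positivity)
  set u := ‖∑ a ∈ Finset.range (2 * q), unitExp (a * x)‖
  set v := ‖∑ a ∈ Finset.range q, unitExp (a * x)‖
  set j := cellIndex (c / q) x
  set y := distNearestInt x
  push_cast at a1
  rw [mul_one_div, div_div, le_div_iff₀ (by positivity)]
  have hc2 : c ^ 2 ≤ 1 := by nlinarith
  rcases le_or_gt |j| 1 with h | h
  · have h' : |(j : ℝ)| ≤ 1 := by exact_mod_cast h
    have hj2 : (j : ℝ) ^ 2 ≤ 1 := by rw [← sq_abs]; nlinarith [abs_nonneg (j : ℝ)]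
    have huv : u * v ≤ 2 * q * q := by gcongr
    have : c ^ 2 * (1 + (j : ℝ) ^ 2) ≤ 1 * (1 + 1) := by gcongr
    calc u * v * (c ^ 2 * (1 + (j : ℝ) ^ 2)) ≤ 2 * q * q * (1 * (1 + 1)) := by gcongr
      _ ≤ 8 * (q : ℝ) ^ 2 := by nlinarith
  · have h' : 2 ≤ |(j : ℝ)| := by exact_mod_cast h
    have hw : c * |(j : ℝ)| ≤ q * (2 * y) := by
      have e : c / q * (|(j : ℝ)| - 1) * q = c * (|(j : ℝ)| - 1) := by field_simp
      nlinarith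
    have hu : u * (c * |(j : ℝ)|) ≤ q := by
      calc u * (c * |(j : ℝ)|) ≤ u * (q * (2 * y)) := by gcongr
        _ = q * (u * (2 * y)) := by ring
        _ ≤ q * 1 := by gcongr
        _ = q := mul_one _
    have hv : v * (c * |(j : ℝ)|) ≤ q := by
      calc v * (c * |(j : ℝ)|) ≤ v * (q * (2 * y)) := by gcongr
        _ = q * (v * (2 * y)) := by ring
        _ ≤ q * 1 := by gcongr
        _ = q := mul_one _
    have huv : u * (c * |(j : ℝ)|) * (v * (c * |(j : ℝ)|)) ≤ q * q := by gcongr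
    have e : u * (c * |(j : ℝ)|) * (v * (c * |(j : ℝ)|)) = u * v * (c ^ 2 * (j : ℝ) ^ 2) := by
      rw [← sq_abs (j : ℝ)]; ring
    have hj2 : 1 ≤ (j : ℝ) ^ 2 := by rw [← sq_abs]; nlinarith
    calc u * v * (c ^ 2 * (1 + (j : ℝ) ^ 2)) ≤ u * v * (c ^ 2 * ((j : ℝ) ^ 2 + (j : ℝ) ^ 2)) := by
          gcongr
      _ = 2 * (u * v * (c ^ 2 * (j : ℝ) ^ 2)) := by ring
      _ ≤ 8 * (q : ℝ) ^ 2 := by nlinarith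

lemma exists_sum_one_div_one_add_sq_le :
    ∃ T : ℝ, ∀ F : Finset ℤ, ∑ j ∈ F, 1 / (1 + (j : ℝ) ^ 2) ≤ T := by
  have hs : Summable fun j : ℤ => 1 / (1 + (j : ℝ) ^ 2) := by
    have h0 : Summable fun j : ℤ => 1 / (j : ℝ) ^ 2 :=
      Real.summable_one_div_int_pow.2 (by norm_num)
    refine h0.of_norm_bounded_eventually ?_
    filter_upwards [(Set.finite_singleton (0 : ℤ)).compl_mem_cofinite] with j hj
    have hj0 : (j : ℝ) ≠ 0 := by exact_mod_cast hj
    rw [Real.norm_of_nonneg (by positivity)]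
    gcongr
    linarith
  exact ⟨∑' j : ℤ, 1 / (1 + (j : ℝ) ^ 2), fun F => hs.sum_le_tsum F fun j _ => by positivity⟩

lemma sum_prod_le_pow_of_injOn {ι κ : Type*} {d : ℕ} (s : Finset ι) (J : ι → Fin d → κ)
    (hJ : Set.InjOn J s) (g : κ → ℝ) (hg : ∀ j, 0 ≤ g j) {T : ℝ}
    (hT : ∀ F : Finset κ, ∑ j ∈ F, g j ≤ T) :
    ∑ k ∈ s, ∏ i, g (J k i) ≤ T ^ d := by
  classical
  rw [← Finset.sum_image (f := fun v : Fin d → κ => ∏ i, g (v i)) hJ]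
  calc ∑ v ∈ s.image J, ∏ i, g (v i)
      ≤ ∑ v ∈ Fintype.piFinset fun i => s.image fun k => J k i, ∏ i, g (v i) := by
        refine Finset.sum_le_sum_of_subset_of_nonneg ?_ fun v _ _ =>
          Finset.prod_nonneg fun i _ => hg _
        intro v hv
        obtain ⟨k, hk, rfl⟩ := Finset.mem_image.1 hv
        exact Fintype.mem_piFinset.2 fun i => Finset.mem_image.2 ⟨k, hk, rfl⟩
    _ = ∏ i, ∑ j ∈ s.image fun k => J k i, g j := (Finset.prod_univ_sum _ _).symm
    _ ≤ ∏ _i : Fin d, T := by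
        refine Finset.prod_le_prod (fun i _ => Finset.sum_nonneg fun j _ => hg j) fun i _ => hT _
    _ = T ^ d := by simp

lemma card_mul_card_mul_le_sum {G : Type*} [AddCancelCommMonoid G] (P U V : Finset G)
    (f : G → G → ℝ) (hf : ∀ a b, 0 ≤ f a b) {C : ℝ} (hPV : ∀ p ∈ P, ∀ b ∈ V, p + b ∈ U)
    (hC : ∀ p ∈ P, ∀ b ∈ V, C ≤ f (p + b) b) :
    (P.card : ℝ) * V.card * C ≤ ∑ a ∈ U, ∑ b ∈ V, f a b := by
  classical
  rw [Finset.sum_comm, mul_assoc, mul_left_comm, ← nsmul_eq_mul]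
  refine Finset.card_nsmul_le_sum _ _ _ fun b hb => ?_
  have hinj : Set.InjOn (fun p => p + b) (P : Set G) := fun p _ p' _ h => add_right_cancel h
  calc (P.card : ℝ) * C ≤ ∑ p ∈ P, f (p + b) b := by
        rw [← nsmul_eq_mul]
        exact Finset.card_nsmul_le_sum _ _ _ fun p hp => hC p hp b hb
    _ = ∑ a ∈ P.image fun p => p + b, f a b := by rw [Finset.sum_image hinj]
    _ ≤ ∑ a ∈ U, f a b := by
        refine Finset.sum_le_sum_of_subset_of_nonneg ?_ fun _ _ _ => hf _ _
        intro a ha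
        obtain ⟨p, hp, rfl⟩ := Finset.mem_image.1 ha
        exact hPV p hp b hb

lemma sum_norm_sq_sum_unitExp_le {ι : Type*} {d : ℕ} (B : Finset ι) (τ : ι → ℝ)
    (Θ : ι → Fin d → ℝ) (m n : ℕ) :
    ∑ a ∈ Fintype.piFinset fun _ : Fin d => Finset.range m,
      ∑ b ∈ Fintype.piFinset fun _ : Fin d => Finset.range n,
        ‖∑ k ∈ B, unitExp (τ k + ∑ i, ((a i : ℝ) - b i) * Θ k i)‖ ^ 2 ≤
    ∑ l ∈ B, ∑ k ∈ B, ∏ i, (‖∑ a ∈ Finset.range m, unitExp (a * (Θ k i - Θ l i))‖ *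
      ‖∑ b ∈ Finset.range n, unitExp (b * (Θ k i - Θ l i))‖) := by
  have expand : ∀ a b : Fin d → ℕ,
      ((‖∑ k ∈ B, unitExp (τ k + ∑ i, ((a i : ℝ) - b i) * Θ k i)‖ ^ 2 : ℝ) : ℂ) =
      ∑ l ∈ B, ∑ k ∈ B, unitExp (τ k - τ l) *
        ((∏ i, unitExp (a i * (Θ k i - Θ l i))) * ∏ i, unitExp (-(b i * (Θ k i - Θ l i)))) := by
    intro a b
    rw [Complex.ofReal_pow, ← Complex.conj_mul', map_sum, Finset.sum_mul_sum]
    refine Finset.sum_congr rfl fun l _ => Finset.sum_congr rfl fun k _ => ?_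
    rw [conj_unitExp, ← unitExp_add, ← unitExp_sum, ← unitExp_sum, ← unitExp_add, ← unitExp_add]
    congr 1
    rw [← Finset.sum_add_distrib, neg_add, ← Finset.sum_neg_distrib]
    have : ∑ i, (a i * (Θ k i - Θ l i) + -(b i * (Θ k i - Θ l i))) =
        ∑ i, -(((a i : ℝ) - b i) * Θ l i) + ∑ i, ((a i : ℝ) - b i) * Θ k i := by
      rw [← Finset.sum_add_distrib]
      exact Finset.sum_congr rfl fun i _ => by ring
    rw [this]
    ring
  have key : ((∑ a ∈ Fintype.piFinset fun _ : Fin d => Finset.range m,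
      ∑ b ∈ Fintype.piFinset fun _ : Fin d => Finset.range n,
        ‖∑ k ∈ B, unitExp (τ k + ∑ i, ((a i : ℝ) - b i) * Θ k i)‖ ^ 2 : ℝ) : ℂ) =
      ∑ l ∈ B, ∑ k ∈ B, unitExp (τ k - τ l) *
        ∏ i, ((∑ a ∈ Finset.range m, unitExp (a * (Θ k i - Θ l i))) *
          ∑ b ∈ Finset.range n, unitExp (-(b * (Θ k i - Θ l i)))) := by
    rw [Complex.ofReal_sum]
    simp only [Complex.ofReal_sum, expand]
    simp only [Finset.prod_mul_distrib, Finset.prod_univ_sum]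
    have swap : ∀ F : (Fin d → ℕ) → ι → ι → ℂ, ∀ U : Finset (Fin d → ℕ),
        ∑ a ∈ U, ∑ l ∈ B, ∑ k ∈ B, F a l k = ∑ l ∈ B, ∑ k ∈ B, ∑ a ∈ U, F a l k := by
      intro F U
      rw [Finset.sum_comm]
      exact Finset.sum_congr rfl fun l _ => Finset.sum_comm
    simp only [swap]
    refine Finset.sum_congr rfl fun l _ => Finset.sum_congr rfl fun k _ => ?_
    rw [Finset.sum_mul_sum, Finset.mul_sum]
    exact Finset.sum_congr rfl fun a _ => (Finset.mul_sum _ _ _).symm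
  have hn := congrArg norm key
  rw [Complex.norm_real, Real.norm_of_nonneg (by positivity)] at hn
  rw [hn]
  refine (norm_sum_le _ _).trans (Finset.sum_le_sum fun l _ => (norm_sum_le _ _).trans
    (Finset.sum_le_sum fun k _ => ?_))
  rw [norm_mul, norm_unitExp, one_mul, norm_prod]
  simp only [norm_mul, norm_sum_unitExp_neg]
  exact le_rfl

/-- A dual large-sieve bound: if the vectors `A k` with `|k|_∞ < K` are `c / q`-separated modulo
one, then few integer points of `[0, q]^d` are mapped by an affine map with linear part `A`
into a small neighbourhood of the integer lattice. -/
lemma card_mul_pow_le_of_separated {d m q K : ℕ} (hq : 0 < q) (hK : 0 < K)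
    (A : Matrix (Fin d) (Fin m) ℝ) (t : Fin m → ℝ) {c T ε : ℝ} (hc : 0 < c) (hc1 : c ≤ 1)
    (hT : ∀ F : Finset ℤ, ∑ j ∈ F, 1 / (1 + (j : ℝ) ^ 2) ≤ T)
    (hsep : ∀ k : Fin m → ℤ, k ≠ 0 → (∀ j, |k j| < K) →
      ∃ i, c / q ≤ distNearestInt (∑ j, A i j * (k j : ℝ)))
    (hε : m * (((K : ℝ) - 1) * ε) ≤ 1 / 6)
    (P : Finset (Fin d → ℕ))
    (hP : ∀ p ∈ P, (∀ i, p i ≤ q) ∧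
      ∃ r : Fin m → ℤ, ∀ j, |t j + ∑ i, (p i : ℝ) * A i j - r j| ≤ ε) :
    (P.card : ℝ) * (K : ℝ) ^ m ≤ 4 * (8 * T / c ^ 2) ^ d * (q : ℝ) ^ d := by
  classical
  have hq' : (0 : ℝ) < q := by exact_mod_cast hq
  have hK' : (1 : ℝ) ≤ K := by exact_mod_cast hK
  set B : Finset (Fin m → ℕ) := Fintype.piFinset fun _ => Finset.range K with hB
  have hBcard : (B.card : ℝ) = (K : ℝ) ^ m := by simp [hB]
  let τ : (Fin m → ℕ) → ℝ := fun k => ∑ j, (k j : ℝ) * t j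
  let Θ : (Fin m → ℕ) → Fin d → ℝ := fun k i => ∑ j, A i j * (k j : ℝ)
  let f : (Fin d → ℕ) → (Fin d → ℕ) → ℝ := fun a b =>
    ‖∑ k ∈ B, unitExp (τ k + ∑ i, ((a i : ℝ) - b i) * Θ k i)‖ ^ 2
  set U := Fintype.piFinset fun _ : Fin d => Finset.range (2 * q) with hU
  set V := Fintype.piFinset fun _ : Fin d => Finset.range q with hV
  have lower : ∀ p ∈ P, ∀ b : Fin d → ℕ, ((K : ℝ) ^ m / 2) ^ 2 ≤ f (p + b) b := by
    intro p hp b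
    obtain ⟨-, r, hr⟩ := hP p hp
    refine pow_le_pow_left₀ (by positivity) (le_trans ?_ (Complex.re_le_norm _)) 2
    rw [Complex.re_sum, ← hBcard, div_eq_mul_one_div, ← nsmul_eq_mul]
    refine Finset.card_nsmul_le_sum _ _ _ fun k hk => ?_
    apply half_le_re_unitExp (∑ j, k j * r j)
    have e : τ k + ∑ i, (((p + b) i : ℕ) - (b i : ℝ)) * Θ k i - ((∑ j, k j * r j : ℤ) : ℝ) =
        ∑ j, (k j : ℝ) * (t j + ∑ i, (p i : ℝ) * A i j - r j) := by
      have e1 : ∑ i, (((p + b) i : ℕ) - (b i : ℝ)) * Θ k i =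
          ∑ j, (k j : ℝ) * ∑ i, (p i : ℝ) * A i j := by
        simp only [Θ, Finset.mul_sum]
        rw [Finset.sum_comm]
        refine Finset.sum_congr rfl fun j _ => Finset.sum_congr rfl fun i _ => ?_
        simp only [Pi.add_apply]
        push_cast
        ring
      rw [e1]
      simp only [mul_sub, mul_add, Finset.sum_sub_distrib, Finset.sum_add_distrib, τ]
      push_cast
      rfl
    rw [e]
    refine (Finset.abs_sum_le_sum_abs _ _).trans (le_trans ?_ hε)
    have hb : ∀ j ∈ (Finset.univ : Finset (Fin m)),
        |(k j : ℝ) * (t j + ∑ i, (p i : ℝ) * A i j - r j)| ≤ ((K : ℝ) - 1) * ε := by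
      intro j _
      have hkj : k j + 1 ≤ K := Finset.mem_range.1 (Fintype.mem_piFinset.1 hk j)
      have hkj' : (k j : ℝ) ≤ K - 1 := by
        have : (k j : ℝ) + 1 ≤ K := by exact_mod_cast hkj
        linarith
      rw [abs_mul, abs_of_nonneg (by positivity)]
      exact mul_le_mul hkj' (hr j) (abs_nonneg _) (by linarith)
    simpa using Finset.sum_le_card_nsmul _ _ _ hb
  have hlow : (P.card : ℝ) * (q : ℝ) ^ d * ((K : ℝ) ^ m / 2) ^ 2 ≤ ∑ a ∈ U, ∑ b ∈ V, f a b := by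
    have hVcard : (V.card : ℝ) = (q : ℝ) ^ d := by simp [hV]
    rw [← hVcard]
    refine card_mul_card_mul_le_sum P U V f (fun _ _ => sq_nonneg _) ?_ fun p hp b _ => lower p hp b
    intro p hp b hb
    refine Fintype.mem_piFinset.2 fun i => ?_
    have h1 := (hP _ hp).1 i
    have h2 := Finset.mem_range.1 (Fintype.mem_piFinset.1 hb i)
    simp only [Finset.mem_range, Pi.add_apply]
    omega
  have hup : ∑ a ∈ U, ∑ b ∈ V, f a b ≤
      (K : ℝ) ^ m * ((8 * (q : ℝ) ^ 2 / c ^ 2) * T) ^ d := by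
    refine (sum_norm_sq_sum_unitExp_le B τ Θ (2 * q) q).trans ?_
    rw [← hBcard, ← nsmul_eq_mul]
    refine Finset.sum_le_card_nsmul _ _ _ fun l _ => ?_
    refine le_trans (Finset.sum_le_sum fun k _ => Finset.prod_le_prod
      (fun i _ => by positivity) fun i _ => kernel_bound hc hc1 hq (Θ k i - Θ l i)) ?_
    refine sum_prod_le_pow_of_injOn B (fun k i => cellIndex (c / q) (Θ k i - Θ l i)) ?_
      (fun j : ℤ => 8 * (q : ℝ) ^ 2 / c ^ 2 * (1 / (1 + (j : ℝ) ^ 2)))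
      (fun j => by positivity) fun F => ?_
    · intro k hk k' hk' h
      by_contra hne
      obtain ⟨i, hi⟩ := hsep (fun j => (k j : ℤ) - k' j)
        (fun h0 => hne (funext fun j => by
          have h1 : (k j : ℤ) - k' j = 0 := congrFun h0 j
          omega))
        (fun j => by
          have h1 := Finset.mem_range.1 (Fintype.mem_piFinset.1 hk j)
          have h2 := Finset.mem_range.1 (Fintype.mem_piFinset.1 hk' j)
          rw [abs_lt]
          constructor <;> omega)
      have h1 := distNearestInt_sub_lt_of_cellIndex_eq (by positivity) (congrFun h i)
      refine absurd hi (not_le.2 ?_)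
      have e : ∑ j, A i j * (((k j : ℤ) - k' j : ℤ) : ℝ) =
          (Θ k i - Θ l i) - (Θ k' i - Θ l i) := by
        rw [sub_sub_sub_cancel_right, ← Finset.sum_sub_distrib]
        exact Finset.sum_congr rfl fun j _ => by push_cast; ring
      rw [e]
      exact h1
    · rw [← Finset.mul_sum]
      gcongr
      exact hT F
  have h := hlow.trans hup
  have hKm : (0 : ℝ) < (K : ℝ) ^ m := by positivity
  have hqd : (0 : ℝ) < (q : ℝ) ^ d := by positivity
  have e : (K : ℝ) ^ m * ((8 * (q : ℝ) ^ 2 / c ^ 2) * T) ^ d =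
      (4 * (8 * T / c ^ 2) ^ d * (q : ℝ) ^ d) * ((K : ℝ) ^ m * (q : ℝ) ^ d / 4) := by
    have : 8 * (q : ℝ) ^ 2 / c ^ 2 * T = (8 * T / c ^ 2) * (q * q) := by ring
    rw [this, mul_pow, mul_pow]
    ring
  rw [e] at h
  have e2 : (P.card : ℝ) * (q : ℝ) ^ d * ((K : ℝ) ^ m / 2) ^ 2 =
      ((P.card : ℝ) * (K : ℝ) ^ m) * ((K : ℝ) ^ m * (q : ℝ) ^ d / 4) := by ring
  rw [e2] at h
  exact le_of_mul_le_mul_right h (by positivity)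

lemma exists_le_distNearestInt_of_bad {d m q : ℕ} (hd : 1 ≤ d) (hq : 0 < q)
    (A : Matrix (Fin d) (Fin m) ℝ) {φ : ℝ → ℝ} (hφmono : ∀ x y, 1 ≤ x → x ≤ y → φ y ≤ φ x)
    (hbad : ∀ k : Fin m → ℤ, k ≠ 0 →
      φ (intSupNorm k) ≤ intSupNorm k ^ m * ∏ i, distNearestInt (∑ j, A i j * (k j : ℝ)))
    {c y : ℝ} (hc : 0 < c) (hc1 : c ≤ 1) (hy : 0 < y)
    (h : c / (q : ℝ) ^ d < φ (1 / y) * y ^ m) {k : Fin m → ℤ} (hk : k ≠ 0)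
    (hky : ∀ j, |(k j : ℝ)| ≤ 1 / y) :
    ∃ i, c / q ≤ distNearestInt (∑ j, A i j * (k j : ℝ)) := by
  by_contra! hcon
  have hn : intSupNorm k ≤ 1 / y := (pi_norm_le_iff_of_nonneg (by positivity)).2 hky
  have hn1 : 1 ≤ intSupNorm k := by
    obtain ⟨j, hj⟩ := Function.ne_iff.1 hk
    refine le_trans ?_ (norm_le_pi_norm (fun j => (k j : ℝ)) j)
    rw [Real.norm_eq_abs]
    exact_mod_cast Int.one_le_abs hj
  have hprod : ∏ i, distNearestInt (∑ j, A i j * (k j : ℝ)) ≤ c / (q : ℝ) ^ d := by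
    calc ∏ i, distNearestInt (∑ j, A i j * (k j : ℝ)) ≤ ∏ _i : Fin d, c / (q : ℝ) :=
          Finset.prod_le_prod (fun i _ => abs_nonneg _) fun i _ => (hcon i).le
      _ = c ^ d / (q : ℝ) ^ d := by simp
      _ ≤ c / (q : ℝ) ^ d := by
          gcongr
          exact pow_le_of_le_one hc.le hc1 (by omega)
  have h1 : φ (1 / y) ≤ (1 / y) ^ m * (c / (q : ℝ) ^ d) := by
    refine (hφmono _ _ hn1 hn).trans ((hbad k hk).trans ?_)
    gcongr
    exact Finset.prod_nonneg fun i _ => abs_nonneg _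
  have h2 : φ (1 / y) * y ^ m ≤ (1 / y) ^ m * (c / (q : ℝ) ^ d) * y ^ m := by gcongr
  have h3 : (1 / y) ^ m * (c / (q : ℝ) ^ d) * y ^ m = c / (q : ℝ) ^ d := by
    rw [one_div, inv_pow]
    field_simp
  linarith

lemma card_le_of_bad {d m q : ℕ} (hd : 1 ≤ d) (hm : 1 ≤ m) (hq : 0 < q)
    (A : Matrix (Fin d) (Fin m) ℝ) (t : Fin m → ℝ) {φ : ℝ → ℝ}
    (hφmono : ∀ x y, 1 ≤ x → x ≤ y → φ y ≤ φ x)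
    (hbad : ∀ k : Fin m → ℤ, k ≠ 0 →
      φ (intSupNorm k) ≤ intSupNorm k ^ m * ∏ i, distNearestInt (∑ j, A i j * (k j : ℝ)))
    {c y Y C T : ℝ} (hc : 0 < c) (hc1 : c ≤ 1) (hy : 0 < y) (hyY : y ≤ Y) (hC : 1 ≤ C)
    (hT : ∀ F : Finset ℤ, ∑ j ∈ F, 1 / (1 + (j : ℝ) ^ 2) ≤ T)
    (h : c / (q : ℝ) ^ d < φ (1 / y) * y ^ m) (P : Finset (Fin d → ℕ))
    (hP : ∀ p ∈ P, (∀ i, p i ≤ q) ∧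
      ∃ r : Fin m → ℤ, ∀ j, |t j + ∑ i, (p i : ℝ) * A i j - r j| ≤ C * Y) :
    (P.card : ℝ) ≤ 4 * (8 * T / c ^ 2) ^ d * (6 * m * C) ^ m * ((q : ℝ) ^ d * Y ^ m) := by
  have hY : 0 < Y := hy.trans_le hyY
  have hm' : (1 : ℝ) ≤ m := by exact_mod_cast hm
  have hW : 0 < 6 * m * C * Y := by positivity
  set R : ℝ := 1 / (6 * m * C * Y) with hR
  have hR0 : 0 ≤ R := by positivity
  have hfl : ((⌊R⌋₊ : ℕ) : ℝ) ≤ R := Nat.floor_le hR0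
  have hRy : R ≤ 1 / y := by
    have : 1 ≤ 6 * m * C := by nlinarith
    apply one_div_le_one_div_of_le hy
    nlinarith
  have key := card_mul_pow_le_of_separated (K := ⌊R⌋₊ + 1) hq (Nat.succ_pos _) A t hc hc1 hT
    (fun k hk hkK => exists_le_distNearestInt_of_bad hd hq A hφmono hbad hc hc1 hy h hk
      fun j => by
        have h1 : |k j| ≤ (⌊R⌋₊ : ℤ) := by
          have := hkK j
          push_cast at this
          omega
        have h2 : |(k j : ℝ)| ≤ (⌊R⌋₊ : ℝ) := by exact_mod_cast h1
        linarith)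
    (ε := C * Y) (by
      push_cast
      have h1 : R * (6 * m * C * Y) = 1 := by rw [hR]; field_simp
      have h2 : (⌊R⌋₊ : ℝ) * (6 * m * C * Y) ≤ R * (6 * m * C * Y) := by gcongr
      linarith) P hP
  have hK : R ≤ ((⌊R⌋₊ + 1 : ℕ) : ℝ) := by
    push_cast
    exact (Nat.lt_floor_add_one R).le
  have h1 : (P.card : ℝ) * R ^ m ≤ 4 * (8 * T / c ^ 2) ^ d * (q : ℝ) ^ d :=
    le_trans (by gcongr) key
  rw [hR, one_div, inv_pow, ← div_eq_mul_inv, div_le_iff₀ (by positivity), mul_pow] at h1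
  linarith

open MeasureTheory Filter Topology in
/-- The Hausdorff–Cantelli lemma. -/
lemma hausdorffMeasure_eq_zero_of_cover {X κ : Type*} [EMetricSpace X] [MeasurableSpace X]
    [BorelSpace X] [Countable κ] {s : ℝ} (hs : 0 ≤ s) (S : Set X) (P : ℕ → Finset κ)
    (t : ℕ → κ → Set X) (ρ r : ℕ → ENNReal) (hr : Antitone r) (hr0 : Tendsto r atTop (𝓝 0))
    (hρr : ∀ q, ρ q ≤ r q) (hdiam : ∀ q, ∀ p ∈ P q, Metric.ediam (t q p) ≤ ρ q)
    (hsum : ∑' q, ((P q).card : ENNReal) * ρ q ^ s ≠ ⊤)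
    (hcov : ∀ z ∈ S, ∀ n, ∃ q, n ≤ q ∧ ∃ p ∈ P q, z ∈ t q p) :
    μH[s] S = 0 := by
  have h := Measure.hausdorffMeasure_le_liminf_tsum (ι := fun n : ℕ => Σ k : ℕ, P (k + n)) s S r
    hr0 (fun n i => t (i.1 + n) i.2)
    (Eventually.of_forall fun n i => (hdiam _ _ i.2.2).trans
      ((hρr _).trans (hr (Nat.le_add_left _ _))))
    (Eventually.of_forall fun n z hz => by
      obtain ⟨q, hq, p, hp, hzt⟩ := hcov z hz n
      obtain ⟨k, rfl⟩ := Nat.exists_eq_add_of_le' hq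
      exact Set.mem_iUnion.2 ⟨⟨k, ⟨p, hp⟩⟩, hzt⟩)
  have hlim := ENNReal.tendsto_sum_nat_add _ hsum
  refine le_antisymm (h.trans ?_) zero_le
  rw [← hlim.liminf_eq]
  refine liminf_le_liminf (Eventually.of_forall fun n => ?_)
  simp only [ENNReal.tsum_sigma']
  refine ENNReal.tsum_le_tsum fun k => ?_
  rw [tsum_fintype]
  calc ∑ p : P (k + n), Metric.ediam (t (k + n) p) ^ s
      ≤ ∑ _p : P (k + n), ρ (k + n) ^ s :=
        Finset.sum_le_sum fun p _ => ENNReal.rpow_le_rpow (hdiam _ _ p.2) hs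
    _ = ((P (k + n)).card : ENNReal) * ρ (k + n) ^ s := by simp

lemma EuclideanSpace.dist_le_mul_of_forall_abs_le {N : ℕ} {z w : EuclideanSpace ℝ (Fin N)} {M : ℝ}
    (hM : 0 ≤ M) (h : ∀ i, |z i - w i| ≤ M) : dist z w ≤ N * M := by
  rw [EuclideanSpace.dist_eq]
  refine Real.sqrt_le_iff.2 ⟨by positivity, ?_⟩
  have h1 : ∑ i, dist (z i) (w i) ^ 2 ≤ N * M ^ 2 := by
    have := Finset.sum_le_card_nsmul Finset.univ (fun i => dist (z i) (w i) ^ 2) (M ^ 2)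
      fun i _ => by
        rw [Real.dist_eq]
        exact pow_le_pow_left₀ (abs_nonneg _) (h i) 2
    simpa using this
  have h2 : (N : ℝ) ≤ (N : ℝ) ^ 2 := by exact_mod_cast Nat.le_self_pow two_ne_zero N
  calc ∑ i, dist (z i) (w i) ^ 2 ≤ N * M ^ 2 := h1
    _ ≤ (N : ℝ) ^ 2 * M ^ 2 := by gcongr
    _ = (N * M) ^ 2 := by ring

lemma abs_sum_mul_le_of_abs_le {d m : ℕ} (A : Matrix (Fin d) (Fin m) ℝ) {v : Fin d → ℝ} {M : ℝ}
    (hM : 0 ≤ M) (hv : ∀ i, |v i| ≤ M) (j : Fin m) :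
    |∑ i, v i * A i j| ≤ (∑ j, ∑ i, |A i j|) * M := by
  calc |∑ i, v i * A i j| ≤ ∑ i, |A i j| * M := by
        refine (Finset.abs_sum_le_sum_abs _ _).trans (Finset.sum_le_sum fun i _ => ?_)
        rw [abs_mul, mul_comm]
        exact mul_le_mul_of_nonneg_left (hv i) (abs_nonneg _)
    _ = (∑ i, |A i j|) * M := (Finset.sum_mul _ _ _).symm
    _ ≤ (∑ j, ∑ i, |A i j|) * M := by
        refine mul_le_mul_of_nonneg_right ?_ hM
        exact Finset.single_le_sum (f := fun j => ∑ i, |A i j|)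
          (fun j _ => Finset.sum_nonneg fun i _ => abs_nonneg _) (Finset.mem_univ j)

lemma summable_max_rpow_mul {f g w : ℕ → ℝ} {e : ℝ} (hf : ∀ q, 0 < f q) (hg : ∀ q, 0 < g q)
    (hw : ∀ q, 0 ≤ w q) (hfs : Summable fun q => f q ^ e * w q)
    (hgs : Summable fun q => g q ^ e * w q) : Summable fun q => max (f q) (g q) ^ e * w q := by
  refine Summable.of_nonneg_of_le (fun q => ?_) (fun q => ?_) (hfs.add hgs)
  · exact mul_nonneg (Real.rpow_nonneg (le_max_of_le_left (hf q).le) _) (hw q)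
  · have h1 := mul_nonneg (Real.rpow_nonneg (hf q).le e) (hw q)
    have h2 := mul_nonneg (Real.rpow_nonneg (hg q).le e) (hw q)
    rcases max_choice (f q) (g q) with h | h <;> rw [h] <;> linarith

lemma exists_nat_eq_round {q : ℕ} {x : ℝ} (hx : x ∈ Set.Icc (0 : ℝ) 1) :
    ∃ p : ℕ, p ≤ q ∧ (p : ℤ) = round ((q : ℝ) * x) := by
  have hq : (0 : ℝ) ≤ q := Nat.cast_nonneg q
  have h := abs_le.1 (abs_sub_round ((q : ℝ) * x))
  have h1 : 0 ≤ (q : ℝ) * x := mul_nonneg hq hx.1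
  have h2 : (q : ℝ) * x ≤ q := mul_le_of_le_one_right hq hx.2
  have h3 : (-1 : ℝ) < (round ((q : ℝ) * x) : ℤ) := by linarith [h.2]
  have h4 : ((round ((q : ℝ) * x) : ℤ) : ℝ) < q + 1 := by linarith [h.1]
  have h3' : -1 < round ((q : ℝ) * x) := by exact_mod_cast h3
  have h4' : round ((q : ℝ) * x) < q + 1 := by exact_mod_cast h4
  exact ⟨(round ((q : ℝ) * x)).toNat, by omega, by omega⟩

open MeasureTheory in
/-- **Proposition 1.15**: strong generalised Baker–Schmidt type zero-measure statement for the
subspace `ℋ`, under a `φ`-semi multiplicative badly approximable hypothesis on `A`. -/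
theorem hausdorff_measure_zero_strong (d N : ℕ) (hd : 1 ≤ d) (hdN : d < N) (s : ℝ) (hs : 0 ≤ s)
    (A : Matrix (Fin d) (Fin (N - d)) ℝ) (α₀ : Fin (N - d) → ℝ)
    (Atil : Matrix (Fin (d + 1)) (Fin (N - d)) ℝ)
    (hAtil : Atil = Matrix.of (Fin.cons α₀ (fun i => A i)))
    (φ : ℝ → ℝ) (hφ01 : ∀ x, 1 ≤ x → 0 < φ x ∧ φ x ≤ 1)
    (hφmono : ∀ x y, 1 ≤ x → x ≤ y → φ y ≤ φ x)
    -- `A` is `φ`-semi multiplicatively badly approximable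
    (hbad : ∀ q : Fin (N - d) → ℤ, q ≠ 0 →
      φ (intSupNorm q) ≤ intSupNorm q ^ (N - d) *
        ∏ i, distNearestInt (∑ j, A i j * (q j : ℝ)))
    -- (i)
    (hi : ∀ lam : ℝ, 1 ≤ lam → ∃ clam : ℝ, 0 < clam ∧
      ∀ x : ℝ, 1 ≤ x → clam * φ x ≤ φ (lam * x))
    -- (ii)
    (hii : ∃ γ : ℝ, 0 < γ ∧ ∃ c₁ : ℝ, 0 < c₁ ∧ ∀ x : ℝ, 1 ≤ x → c₁ * x ^ (-γ) ≤ φ x)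
    (hii' : ∃ c₂ : ℝ, 0 < c₂ ∧ ∀ x : ℝ, 1 < x → φ x ≤ c₂ / Real.log x)
    -- (iii): `ψ̂` need not be monotone here
    (hiii : ∃ ψhat : ℝ → ℝ, (∀ x, 1 ≤ x → 0 < ψhat x ∧ ψhat x ≤ 1) ∧
      Summable (fun q : ℕ =>
        ψhat ((q : ℝ) + 1) ^ ((N : ℝ) - d + s) * ((q : ℝ) + 1) ^ ((d : ℝ) - s)) ∧
      ∃ c₃ : ℝ, 0 < c₃ ∧ ∀ x : ℝ, 2 ≤ x →
        c₃ * Real.log x ^ (d - 1) / x ^ d ≤ φ (1 / ψhat x) * ψhat x ^ (N - d)) :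
    ∀ ψ : ℝ → ℝ, (∀ x, 1 ≤ x → 0 < ψ x ∧ ψ x ≤ 1) →
      Summable (fun q : ℕ =>
        ψ ((q : ℝ) + 1) ^ ((N : ℝ) - d + s) * ((q : ℝ) + 1) ^ ((d : ℝ) - s)) →
      μH[s] (simultApprox N ψ ∩
        {z : EuclideanSpace ℝ (Fin N) | ∃ x : Fin d → ℝ,
          (∀ i, x i ∈ Set.Icc (0 : ℝ) 1) ∧
          (∀ i : Fin N, (h : (i : ℕ) < d) → z i = x ⟨i, h⟩) ∧
          (∀ j : Fin (N - d), z ⟨d + (j : ℕ), by have := j.isLt; omega⟩ =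
            Matrix.vecMul (Fin.cons 1 x) Atil j)}) = 0 := by
  classical
  intro ψ hψ hψsum
  obtain ⟨ψhat, hψhat, hψhatsum, c₃, hc₃, hlow⟩ := hiii
  obtain ⟨T, hT⟩ := exists_sum_one_div_one_add_sq_le
  have hlog2 : 0 < Real.log 2 := Real.log_pos (by norm_num)
  obtain ⟨c, hc, hc1, hcc₃⟩ : ∃ c : ℝ, 0 < c ∧ c ≤ 1 ∧ c < c₃ * Real.log 2 ^ (d - 1) := by
    have h0 : 0 < c₃ * Real.log 2 ^ (d - 1) := by positivity
    refine ⟨min 1 (c₃ * Real.log 2 ^ (d - 1) / 2), by positivity, min_le_left _ _, ?_⟩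
    exact (min_le_right _ _).trans_lt (half_lt_self h0)
  set C : ℝ := 1 + ∑ j, ∑ i, |A i j| with hC
  have hC1 : 1 ≤ C := le_add_of_nonneg_right
    (Finset.sum_nonneg fun j _ => Finset.sum_nonneg fun i _ => abs_nonneg _)
  set Ψ : ℝ → ℝ := fun x => max (ψ x) (ψhat x) with hΨ
  have hΨ0 : ∀ x, 1 ≤ x → 0 < Ψ x := fun x hx => lt_max_of_lt_left (hψ x hx).1
  have hΨ1 : ∀ x, 1 ≤ x → Ψ x ≤ 1 := fun x hx => max_le (hψ x hx).2 (hψhat x hx).2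
  have one_le_cast : ∀ n : ℕ, (1 : ℝ) ≤ ((n + 2 : ℕ) : ℝ) := fun n => by
    exact_mod_cast (by omega : 1 ≤ n + 2)
  have hvec : ∀ (x : Fin d → ℝ) (j : Fin (N - d)),
      Matrix.vecMul (Fin.cons 1 x) Atil j = α₀ j + ∑ i, x i * A i j := by
    intro x j
    simp [hAtil, Matrix.vecMul, dotProduct, Fin.sum_univ_succ]
  let P : ℕ → Finset (Fin d → ℕ) := fun n =>
    (Fintype.piFinset fun _ => Finset.range (n + 2 + 1)).filter fun p =>
      ∃ r : Fin (N - d) → ℤ, ∀ j, |((n + 2 : ℕ) : ℝ) * α₀ j + ∑ i, (p i : ℝ) * A i j - r j| ≤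
        C * Ψ ((n + 2 : ℕ) : ℝ)
  let t : ℕ → (Fin d → ℕ) → Set (EuclideanSpace ℝ (Fin N)) := fun n p =>
    {z | ∃ x : Fin d → ℝ,
      (∀ i, |((n + 2 : ℕ) : ℝ) * x i - p i| ≤ Ψ ((n + 2 : ℕ) : ℝ)) ∧
      (∀ i : Fin N, (h : (i : ℕ) < d) → z i = x ⟨i, h⟩) ∧
      (∀ j : Fin (N - d), z ⟨d + (j : ℕ), by have := j.isLt; omega⟩ =
        α₀ j + ∑ i, x i * A i j)}
  have hdiam : ∀ n, ∀ p ∈ P n, Metric.ediam (t n p) ≤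
      ENNReal.ofReal (2 * N * C * (Ψ ((n + 2 : ℕ) : ℝ) / ((n + 2 : ℕ) : ℝ))) := by
    intro n p _
    refine Metric.ediam_le ?_
    rintro z ⟨x, hx, hzx, hzx'⟩ w ⟨y, hy, hwy, hwy'⟩
    have hq := one_le_cast n
    set q : ℝ := ((n + 2 : ℕ) : ℝ)
    have hΨq := hΨ0 q hq
    have hxy : ∀ i, |x i - y i| ≤ 2 * (Ψ q / q) := by
      intro i
      have h1 : |q * x i - q * y i| ≤ 2 * Ψ q := by
        have e : q * x i - q * y i = (q * x i - p i) - (q * y i - p i) := by ring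
        rw [e]
        exact (abs_sub _ _).trans (by linarith [hx i, hy i])
      rw [← mul_sub, abs_mul, abs_of_pos (by linarith)] at h1
      rw [← mul_div_assoc, le_div_iff₀ (by linarith)]
      linarith
    have hM : 0 ≤ 2 * (Ψ q / q) := by positivity
    rw [edist_dist]
    apply ENNReal.ofReal_le_ofReal
    refine (EuclideanSpace.dist_le_mul_of_forall_abs_le (M := C * (2 * (Ψ q / q)))
      (by positivity) fun i => ?_).trans (le_of_eq (by ring))
    by_cases hi : (i : ℕ) < d
    · rw [hzx i hi, hwy i hi]
      exact (hxy _).trans (le_mul_of_one_le_left hM hC1)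
    · have hiN := i.isLt
      obtain ⟨j, hj⟩ : ∃ j : Fin (N - d), i = ⟨d + (j : ℕ), by have := j.isLt; omega⟩ :=
        ⟨⟨i - d, by omega⟩, Fin.ext (by simp only; omega)⟩
      rw [hj, hzx', hwy', add_sub_add_left_eq_sub, ← Finset.sum_sub_distrib]
      simp only [← sub_mul]
      refine (abs_sum_mul_le_of_abs_le A hM hxy j).trans ?_
      exact mul_le_mul_of_nonneg_right (by rw [hC]; linarith) hM
  have hcard : ∀ n, ((P n).card : ℝ) ≤ 4 * (8 * T / c ^ 2) ^ d *
      (6 * (N - d : ℕ) * C) ^ (N - d) *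
        (((n + 2 : ℕ) : ℝ) ^ d * Ψ ((n + 2 : ℕ) : ℝ) ^ (N - d)) := by
    intro n
    have hq2 : (2 : ℝ) ≤ ((n + 2 : ℕ) : ℝ) := by exact_mod_cast Nat.le_add_left 2 n
    refine card_le_of_bad hd (by omega) (Nat.succ_pos _) A
      (fun j => ((n + 2 : ℕ) : ℝ) * α₀ j) hφmono hbad hc hc1 (hψhat _ (one_le_cast n)).1
      (le_max_right _ _) hC1 hT (lt_of_lt_of_le ?_ (hlow _ hq2)) (P n) fun p hp => ?_
    · have hlog : Real.log 2 ≤ Real.log ((n + 2 : ℕ) : ℝ) := Real.log_le_log (by norm_num) hq2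
      refine div_lt_div_of_pos_right (hcc₃.trans_le ?_) (by positivity)
      gcongr
    · obtain ⟨h1, h2⟩ := Finset.mem_filter.1 hp
      exact ⟨fun i => Nat.lt_succ_iff.1 (Finset.mem_range.1 (Fintype.mem_piFinset.1 h1 i)), h2⟩
  have hΨsum : Summable fun n : ℕ => Ψ ((n + 2 : ℕ) : ℝ) ^ ((N : ℝ) - d + s) *
      ((n + 2 : ℕ) : ℝ) ^ ((d : ℝ) - s) := by
    have h1 : Summable fun q : ℕ => Ψ ((q : ℝ) + 1) ^ ((N : ℝ) - d + s) *
        ((q : ℝ) + 1) ^ ((d : ℝ) - s) :=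
      summable_max_rpow_mul (fun q => (hψ _ (by simp)).1) (fun q => (hψhat _ (by simp)).1)
        (fun q => by positivity) hψsum hψhatsum
    refine ((summable_nat_add_iff 1).2 h1).congr fun n => ?_
    have e : ((n + 1 : ℕ) : ℝ) + 1 = ((n + 2 : ℕ) : ℝ) := by push_cast; ring
    rw [e]
  refine hausdorffMeasure_eq_zero_of_cover hs _ P t
    (fun n => ENNReal.ofReal (2 * N * C * (Ψ ((n + 2 : ℕ) : ℝ) / ((n + 2 : ℕ) : ℝ))))
    (fun n => ENNReal.ofReal (2 * N * C * (1 / ((n + 2 : ℕ) : ℝ)))) ?_ ?_ ?_ hdiam ?_ ?_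
  · intro a b hab
    apply ENNReal.ofReal_le_ofReal
    gcongr
  · have h1 : Filter.Tendsto (fun n : ℕ => 2 * N * C * (1 / ((n + 2 : ℕ) : ℝ))) Filter.atTop
        (nhds (2 * N * C * 0)) :=
      (((Filter.tendsto_add_atTop_iff_nat 2).2
        (tendsto_one_div_atTop_nhds_zero_nat (𝕜 := ℝ)))).const_mul _
    have h2 := ENNReal.tendsto_ofReal h1
    rwa [mul_zero, ENNReal.ofReal_zero] at h2
  · intro n
    apply ENNReal.ofReal_le_ofReal
    gcongr
    exact hΨ1 _ (one_le_cast n)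
  · set C₁ : ℝ := 4 * (8 * T / c ^ 2) ^ d * (6 * (N - d : ℕ) * C) ^ (N - d)
    refine ne_top_of_le_ne_top
      (((hΨsum.mul_left (C₁ * (2 * N * C) ^ s))).tsum_ofReal_ne_top) ?_
    refine ENNReal.tsum_le_tsum fun n => ?_
    have hcard' := hcard n
    have hq := one_le_cast n
    set q : ℝ := ((n + 2 : ℕ) : ℝ)
    have hq0 : 0 < q := by linarith
    have hΨq := hΨ0 q hq
    rw [ENNReal.ofReal_rpow_of_nonneg (by positivity) hs, ← ENNReal.ofReal_natCast,
      ← ENNReal.ofReal_mul (Nat.cast_nonneg _)]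
    apply ENNReal.ofReal_le_ofReal
    refine (mul_le_mul_of_nonneg_right hcard' (by positivity)).trans (le_of_eq ?_)
    have hN : (N : ℝ) - d + s = ((N - d : ℕ) : ℝ) + s := by rw [Nat.cast_sub hdN.le]
    rw [hN, Real.rpow_add hΨq, Real.rpow_sub hq0, Real.mul_rpow (by positivity) (by positivity),
      Real.div_rpow hΨq.le hq0.le, Real.rpow_natCast, Real.rpow_natCast]
    ring
  · rintro z ⟨hz, x, hx01, hzx, hzx'⟩ n
    obtain ⟨q, ⟨-, hq⟩, hnq⟩ := Set.Infinite.exists_gt hz (n + 2)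
    obtain ⟨l, rfl⟩ := Nat.exists_eq_add_of_le' (by omega : 2 ≤ q)
    simp only [hvec] at hzx'
    have hcast := one_le_cast l
    set q : ℝ := ((l + 2 : ℕ) : ℝ)
    have hqΨ : ∀ i, distNearestInt (q * z i) ≤ Ψ q := fun i =>
      (hq i).le.trans (le_max_left _ _)
    choose p hpq hpr using fun i => exists_nat_eq_round (q := l + 2) (hx01 i)
    have hxp : ∀ i, |q * x i - p i| ≤ Ψ q := by
      intro i
      have h1 := hqΨ ⟨i, i.isLt.trans hdN⟩
      rw [hzx _ i.isLt] at h1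
      have h2 : (p i : ℝ) = ((round (q * x i) : ℤ) : ℝ) := by
        rw [← hpr i, Int.cast_natCast]
      rw [h2]
      exact h1
    refine ⟨l, by omega, p, Finset.mem_filter.2 ⟨Fintype.mem_piFinset.2 fun i =>
      Finset.mem_range.2 (Nat.lt_succ_iff.2 (hpq i)),
      fun j => round (q * (α₀ j + ∑ i, x i * A i j)), fun j => ?_⟩, x, hxp, hzx, hzx'⟩
    have h1 := hqΨ ⟨d + (j : ℕ), by have := j.isLt; omega⟩
    rw [hzx', distNearestInt] at h1
    have h2 := abs_sum_mul_le_of_abs_le A (v := fun i => q * x i - p i) (hΨ0 q hcast).le hxp j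
    have e : q * α₀ j + ∑ i, (p i : ℝ) * A i j - (round (q * (α₀ j + ∑ i, x i * A i j)) : ℤ) =
        (q * (α₀ j + ∑ i, x i * A i j) - (round (q * (α₀ j + ∑ i, x i * A i j)) : ℤ)) -
          ∑ i, (q * x i - p i) * A i j := by
      simp only [sub_mul, Finset.sum_sub_distrib, mul_add, Finset.mul_sum, mul_assoc]
      ring
    rw [e, hC, add_mul, one_mul]
    exact (abs_sub _ _).trans (add_le_add h1 h2)
end

section
/- Let Λ ⊂ V be a full-rank lattice weakly admissible for C. Let ε, T > 0, Q ∈ (0,∞)^N, set Q̄ := (∏_{j=1}^N Q_j^{γ_j})^{1/𝒞} and θ := (ε^ℬ Q̄^𝒞)^{1/(ℬ+𝒞)}/ε, and let Z := {x : ∏_i |x_i|₂^{β_i} < ε^ℬ and |x_i|₂ ≤ T for all i} × {y : |y_j|₂ ≤ Q_j for all j} ⊂ V. Let κ > 0, c ∈ ℝ, and a₁, …, a_M ∈ ℝ satisfy Σ_{i=1}^M β_i a_i = 0 and exp(a_i − c) ≥ κ ε/T for all i, and define the linear map Φ : V → V by Φ(x,y) := (θ e^{a₁−c} x₁, …, θ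 e^{a_M−c} x_M, θ^{−ℬ/𝒞}(Q̄/Q₁) y₁, …, θ^{−ℬ/𝒞}(Q̄/Q_N) y_N). Then there is a constant c' > 0, depending only on m, n, β, γ, κ and c, such that for every r > 0: λ₁(Φ(Λ)) ≥ c' · min{ ν(Λ,r), (ε^ℬ Q̄^𝒞)^{1/(ℬ+𝒞)} · r/diam(Z), (ε^ℬ Q̄^𝒞)^{1/(ℬ+𝒞)} · λ₁(Λ∩C)/diam(Z∩C) }, where the last term is interpreted as +∞ if C = {0}. -/
open scoped BigOperators ENNReal

/-- the Euclidean norm `|v|₂` on `V = ∏ᵢ ℝ^{mᵢ} × ∏ⱼ ℝ^{nⱼ}` -/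
noncomputable def vNorm {M N : ℕ} {m : Fin M → ℕ} {n : Fin N → ℕ}
    (v : (∀ i, EuclideanSpace ℝ (Fin (m i))) × (∀ j, EuclideanSpace ℝ (Fin (n j)))) : ℝ :=
  Real.sqrt ((∑ i, ‖v.1 i‖ ^ 2) + ∑ j, ‖v.2 j‖ ^ 2)

/-- the multiplicative norm `Nm(x,y) = ∏ᵢ |xᵢ|₂^{βᵢ} ∏ⱼ |yⱼ|₂^{γⱼ}` -/
noncomputable def multNorm {M N : ℕ} {m : Fin M → ℕ} {n : Fin N → ℕ}
    (β : Fin M → ℝ) (γ : Fin N → ℝ)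
    (v : (∀ i, EuclideanSpace ℝ (Fin (m i))) × (∀ j, EuclideanSpace ℝ (Fin (n j)))) : ℝ :=
  (∏ i, ‖v.1 i‖ ^ β i) * ∏ j, ‖v.2 j‖ ^ γ j

/-- `λ₁(Γ) = inf {|v|₂ : v ∈ Γ \ {0}}`, valued in `ℝ≥0∞` so that `inf ∅ = ∞` -/
noncomputable def lambdaOne {M N : ℕ} {m : Fin M → ℕ} {n : Fin N → ℕ}
    (Γ : Set ((∀ i, EuclideanSpace ℝ (Fin (m i))) × (∀ j, EuclideanSpace ℝ (Fin (n j))))) :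
    ℝ≥0∞ :=
  ⨅ (v ∈ Γ) (_ : v ≠ 0), ENNReal.ofReal (vNorm v)

/-- `diam S = sup {|u - w|₂ : u, w ∈ S}`, valued in `ℝ≥0∞` -/
noncomputable def diamE {M N : ℕ} {m : Fin M → ℕ} {n : Fin N → ℕ}
    (S : Set ((∀ i, EuclideanSpace ℝ (Fin (m i))) × (∀ j, EuclideanSpace ℝ (Fin (n j))))) :
    ℝ≥0∞ :=
  ⨆ (u ∈ S) (w ∈ S), ENNReal.ofReal (vNorm (u - w))

/-- `ν(Λ,ρ) = inf {Nm(v)^{1/(ℬ+𝒞)} : v ∈ Λ \ C, |v|₂ < ρ}`, valued in `ℝ≥0∞`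
so that `inf ∅ = ∞` -/
noncomputable def nuE {M N : ℕ} {m : Fin M → ℕ} {n : Fin N → ℕ}
    (β : Fin M → ℝ) (γ : Fin N → ℝ)
    (Λ Cset : Set ((∀ i, EuclideanSpace ℝ (Fin (m i))) × (∀ j, EuclideanSpace ℝ (Fin (n j)))))
    (ρ : ℝ) : ℝ≥0∞ :=
  ⨅ (v ∈ Λ) (_ : v ∉ Cset) (_ : vNorm v < ρ),
    ENNReal.ofReal (multNorm β γ v ^ (1 / ((∑ i, β i) + ∑ j, γ j)))

section Norms

variable {M N : ℕ} {m : Fin M → ℕ} {n : Fin N → ℕ}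
  (v w : (∀ i, EuclideanSpace ℝ (Fin (m i))) × (∀ j, EuclideanSpace ℝ (Fin (n j))))

theorem vNorm_nonneg : 0 ≤ vNorm v := Real.sqrt_nonneg _

theorem norm_fst_le_vNorm (i : Fin M) : ‖v.1 i‖ ≤ vNorm v := by
  apply Real.le_sqrt_of_sq_le
  have h₁ : ‖v.1 i‖ ^ 2 ≤ ∑ i, ‖v.1 i‖ ^ 2 :=
    Finset.single_le_sum (f := fun i => ‖v.1 i‖ ^ 2) (fun _ _ => sq_nonneg _) (Finset.mem_univ i)
  have h₂ : 0 ≤ ∑ j, ‖v.2 j‖ ^ 2 := Finset.sum_nonneg fun _ _ => sq_nonneg _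
  linarith

theorem norm_snd_le_vNorm (j : Fin N) : ‖v.2 j‖ ≤ vNorm v := by
  apply Real.le_sqrt_of_sq_le
  have h₁ : ‖v.2 j‖ ^ 2 ≤ ∑ j, ‖v.2 j‖ ^ 2 :=
    Finset.single_le_sum (f := fun j => ‖v.2 j‖ ^ 2) (fun _ _ => sq_nonneg _) (Finset.mem_univ j)
  have h₂ : 0 ≤ ∑ i, ‖v.1 i‖ ^ 2 := Finset.sum_nonneg fun _ _ => sq_nonneg _
  linarith

variable {v w} in
/-- A componentwise comparison of norms implies the comparison of Euclidean norms. -/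
theorem mul_vNorm_le_mul_vNorm {K d : ℝ} (hK : 0 ≤ K) (hd : 0 ≤ d)
    (h₁ : ∀ i, K * ‖v.1 i‖ ≤ d * ‖w.1 i‖) (h₂ : ∀ j, K * ‖v.2 j‖ ≤ d * ‖w.2 j‖) :
    K * vNorm v ≤ d * vNorm w := by
  unfold vNorm
  rw [← Real.sqrt_sq hK, ← Real.sqrt_sq hd, ← Real.sqrt_mul (sq_nonneg _),
    ← Real.sqrt_mul (sq_nonneg _)]
  apply Real.sqrt_le_sqrt
  simp only [mul_add, Finset.mul_sum, ← mul_pow]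
  refine add_le_add (Finset.sum_le_sum fun i _ => ?_) (Finset.sum_le_sum fun j _ => ?_)
  · exact pow_le_pow_left₀ (by positivity) (h₁ i) 2
  · exact pow_le_pow_left₀ (by positivity) (h₂ j) 2

theorem multNorm_nonneg (β : Fin M → ℝ) (γ : Fin N → ℝ) : 0 ≤ multNorm β γ v := by
  unfold multNorm
  positivity

theorem multNorm_le_vNorm_rpow {β : Fin M → ℝ} {γ : Fin N → ℝ} (hβ : ∀ i, 0 < β i)
    (hγ : ∀ j, 0 < γ j) :
    multNorm β γ v ≤ vNorm v ^ ((∑ i, β i) + ∑ j, γ j) := by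
  have hB : 0 ≤ ∑ i, β i := Finset.sum_nonneg fun i _ => (hβ i).le
  have hC : 0 ≤ ∑ j, γ j := Finset.sum_nonneg fun j _ => (hγ j).le
  rw [Real.rpow_add_of_nonneg (vNorm_nonneg v) hB hC,
    Real.rpow_sum_of_nonneg (vNorm_nonneg v) fun i _ => (hβ i).le,
    Real.rpow_sum_of_nonneg (vNorm_nonneg v) fun j _ => (hγ j).le]
  unfold multNorm
  gcongr with i _ j _
  · exact Finset.prod_nonneg fun _ _ => Real.rpow_nonneg (vNorm_nonneg v) _
  · exact (hβ i).le
  · exact norm_fst_le_vNorm v i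
  · exact (hγ j).le
  · exact norm_snd_le_vNorm v j

theorem multNorm_smul (β : Fin M → ℝ) (γ : Fin N → ℝ) {s : Fin M → ℝ} {t : Fin N → ℝ}
    (hs : ∀ i, 0 ≤ s i) (ht : ∀ j, 0 ≤ t j) :
    multNorm β γ ((fun i => s i • v.1 i, fun j => t j • v.2 j) :
      (∀ i, EuclideanSpace ℝ (Fin (m i))) × (∀ j, EuclideanSpace ℝ (Fin (n j)))) =
      ((∏ i, s i ^ β i) * ∏ j, t j ^ γ j) * multNorm β γ v := by
  have h₁ : ∀ i, ‖s i • v.1 i‖ ^ β i = s i ^ β i * ‖v.1 i‖ ^ β i := fun i => by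
    rw [norm_smul, Real.norm_of_nonneg (hs i), Real.mul_rpow (hs i) (norm_nonneg _)]
  have h₂ : ∀ j, ‖t j • v.2 j‖ ^ γ j = t j ^ γ j * ‖v.2 j‖ ^ γ j := fun j => by
    rw [norm_smul, Real.norm_of_nonneg (ht j), Real.mul_rpow (ht j) (norm_nonneg _)]
  simp only [multNorm, h₁, h₂, Finset.prod_mul_distrib]
  ring

theorem ofReal_le_diamE {S : Set ((∀ i, EuclideanSpace ℝ (Fin (m i))) ×
    (∀ j, EuclideanSpace ℝ (Fin (n j))))} (h0 : 0 ∈ S) {v} (hv : v ∈ S) {t : ℝ}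
    (ht : t ≤ vNorm v) : ENNReal.ofReal t ≤ diamE S := by
  refine (ENNReal.ofReal_le_ofReal ht).trans ?_
  unfold diamE
  refine le_iSup₂_of_le v hv (le_iSup₂_of_le 0 h0 ?_)
  rw [sub_zero]

variable {v w} in
/-- A distortion `w` of `v` expanding every nonvanishing component by at least `K / t`, where `t`
is bounded by the diameter of `S`, expands the norm by at least `K / diam S`. -/
theorem ofReal_mul_div_diamE_le {S : Set ((∀ i, EuclideanSpace ℝ (Fin (m i))) ×
    (∀ j, EuclideanSpace ℝ (Fin (n j))))} {K : ℝ} (hK : 0 ≤ K)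
    (h₁ : ∀ i, v.1 i ≠ 0 →
      ∃ t, ENNReal.ofReal t ≤ diamE S ∧ K * ‖v.1 i‖ ≤ t * ‖w.1 i‖)
    (h₂ : ∀ j, v.2 j ≠ 0 →
      ∃ t, ENNReal.ofReal t ≤ diamE S ∧ K * ‖v.2 j‖ ≤ t * ‖w.2 j‖) :
    ENNReal.ofReal (K * vNorm v) / diamE S ≤ ENNReal.ofReal (vNorm w) := by
  by_cases hD : diamE S = ⊤
  · simp [hD]
  apply ENNReal.div_le_of_le_mul
  rw [← ENNReal.ofReal_toReal hD, ← ENNReal.ofReal_mul (vNorm_nonneg w)]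
  apply ENNReal.ofReal_le_ofReal
  rw [mul_comm (vNorm w)]
  have hd : 0 ≤ (diamE S).toReal := ENNReal.toReal_nonneg
  refine mul_vNorm_le_mul_vNorm hK hd (fun i => ?_) (fun j => ?_)
  · by_cases hi : v.1 i = 0
    · rw [hi, norm_zero, mul_zero]
      positivity
    obtain ⟨t, htD, htv⟩ := h₁ i hi
    exact htv.trans (mul_le_mul_of_nonneg_right
      ((ENNReal.ofReal_le_iff_le_toReal hD).1 htD) (norm_nonneg _))
  · by_cases hj : v.2 j = 0
    · rw [hj, norm_zero, mul_zero]
      positivity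
    obtain ⟨t, htD, htv⟩ := h₂ j hj
    exact htv.trans (mul_le_mul_of_nonneg_right
      ((ENNReal.ofReal_le_iff_le_toReal hD).1 htD) (norm_nonneg _))

end Norms

/-- **Proposition 2.6**: lower bound for the first minimum of the distorted lattice `Φ(Λ)`. -/
theorem first_minimum_distorted_lattice (M N : ℕ) (hM : 1 ≤ M) (hN : 1 ≤ N)
    (m : Fin M → ℕ) (n : Fin N → ℕ) (hm : ∀ i, 1 ≤ m i) (hn : ∀ j, 1 ≤ n j)
    (β : Fin M → ℝ) (γ : Fin N → ℝ) (hβ : ∀ i, 0 < β i) (hγ : ∀ j, 0 < γ j)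
    (I : Finset (Fin M)) (J : Finset (Fin N)) (hIJ : I.Nonempty ∨ J.Nonempty)
    (κ cc : ℝ) (hκ : 0 < κ) :
    ∃ c' : ℝ, 0 < c' ∧
      ∀ (Λ : Submodule ℤ
          ((∀ i, EuclideanSpace ℝ (Fin (m i))) × (∀ j, EuclideanSpace ℝ (Fin (n j)))))
        (Cset : Set
          ((∀ i, EuclideanSpace ℝ (Fin (m i))) × (∀ j, EuclideanSpace ℝ (Fin (n j))))),
        Cset = {v | (∀ i ∈ I, v.1 i = 0) ∧ ∀ j ∈ J, v.2 j = 0} →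
        -- `Λ` is a full-rank lattice
        DiscreteTopology Λ →
        Submodule.span ℝ (Λ :
          Set ((∀ i, EuclideanSpace ℝ (Fin (m i))) × (∀ j, EuclideanSpace ℝ (Fin (n j))))) = ⊤ →
        -- `Λ` is weakly admissible for `C`
        (∀ ρ : ℝ, 0 < ρ → 0 < nuE β γ (Λ : Set _) Cset ρ) →
      ∀ ε T : ℝ, 0 < ε → 0 < T → ∀ Q : Fin N → ℝ, (∀ j, 0 < Q j) →
      ∀ Qbar θ₀ : ℝ,
        Qbar = (∏ j, Q j ^ γ j) ^ (1 / ∑ j, γ j) →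
        θ₀ = (ε ^ (∑ i, β i) * Qbar ^ (∑ j, γ j)) ^ (1 / ((∑ i, β i) + ∑ j, γ j)) →
      ∀ Zset : Set
          ((∀ i, EuclideanSpace ℝ (Fin (m i))) × (∀ j, EuclideanSpace ℝ (Fin (n j)))),
        Zset = {v | ((∏ i, ‖v.1 i‖ ^ β i) < ε ^ (∑ i, β i) ∧ ∀ i, ‖v.1 i‖ ≤ T) ∧
          ∀ j, ‖v.2 j‖ ≤ Q j} →
      ∀ a : Fin M → ℝ, (∑ i, β i * a i = 0) → (∀ i, κ * (ε / T) ≤ Real.exp (a i - cc)) →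
      ∀ Φ : ((∀ i, EuclideanSpace ℝ (Fin (m i))) × (∀ j, EuclideanSpace ℝ (Fin (n j)))) →
          ((∀ i, EuclideanSpace ℝ (Fin (m i))) × (∀ j, EuclideanSpace ℝ (Fin (n j)))),
        (Φ = fun v =>
          (fun i => ((θ₀ / ε) * Real.exp (a i - cc)) • v.1 i,
           fun j => ((θ₀ / ε) ^ (-((∑ i, β i) / ∑ j, γ j)) * (Qbar / Q j)) • v.2 j)) →
      ∀ r : ℝ, 0 < r →
        ENNReal.ofReal c' *
          min (nuE β γ (Λ : Set _) Cset r)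
            (min (ENNReal.ofReal (θ₀ * r) / diamE Zset)
                 (ENNReal.ofReal θ₀ * lambdaOne ((Λ : Set _) ∩ Cset) / diamE (Zset ∩ Cset)))
          ≤ lambdaOne (Φ '' (Λ : Set _)) := by
  have hB : 0 < ∑ i, β i :=
    Finset.sum_pos (fun i _ => hβ i) ⟨⟨0, hM⟩, Finset.mem_univ _⟩
  have hC : 0 < ∑ j, γ j :=
    Finset.sum_pos (fun j _ => hγ j) ⟨⟨0, hN⟩, Finset.mem_univ _⟩
  set B := ∑ i, β i with hBdef
  set C := ∑ j, γ j with hCdef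
  have hBC : 0 < B + C := add_pos hB hC
  set k : ℝ := min κ (min (Real.exp (-cc)) 1) / 2 with hkdef
  have hk : 0 < k := by positivity
  have hkκ : 2 * k ≤ κ := by
    rw [hkdef, mul_div_cancel₀ _ two_ne_zero]
    exact min_le_left _ _
  have hkexp : 2 * k ≤ Real.exp (-cc) := by
    rw [hkdef, mul_div_cancel₀ _ two_ne_zero]
    exact (min_le_right _ _).trans (min_le_left _ _)
  have hk1 : 2 * k ≤ 1 := by
    rw [hkdef, mul_div_cancel₀ _ two_ne_zero]
    exact (min_le_right _ _).trans (min_le_right _ _)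
  refine ⟨min (Real.exp (-(cc * B)) ^ (1 / (B + C))) k, by positivity, ?_⟩
  intro Λ Cset hCset _ _ _ ε T hε hT Q hQ Qbar θ₀ hQbar hθ₀ Zset hZ a ha haκ Φ hΦ r _
  have hQprod : 0 < ∏ j, Q j ^ γ j :=
    Finset.prod_pos fun j _ => Real.rpow_pos_of_pos (hQ j) _
  have hQbar0 : 0 < Qbar := by
    rw [hQbar]
    positivity
  have hθ₀0 : 0 < θ₀ := by
    rw [hθ₀]
    positivity
  have hQbarC : Qbar ^ C = ∏ j, Q j ^ γ j := by
    rw [hQbar, ← Real.rpow_mul hQprod.le, one_div_mul_cancel hC.ne', Real.rpow_one]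
  have hθ₀BC : θ₀ ^ B * θ₀ ^ C = ε ^ B * Qbar ^ C := by
    rw [← Real.rpow_add hθ₀0, hθ₀, ← Real.rpow_mul (by positivity), one_div_mul_cancel hBC.ne',
      Real.rpow_one]
  have hθpow : (θ₀ / ε) ^ (-(B / C)) = θ₀ / Qbar := by
    have h : (θ₀ / ε) ^ (-B) = (θ₀ / Qbar) ^ C := by
      rw [Real.rpow_neg (by positivity), Real.div_rpow hθ₀0.le hε.le,
        Real.div_rpow hθ₀0.le hQbar0.le, inv_div, div_eq_div_iff (by positivity) (by positivity)]
      linarith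
    rw [← neg_div, div_eq_mul_one_div (-B), Real.rpow_mul (by positivity), h,
      ← Real.rpow_mul (by positivity), mul_one_div_cancel hC.ne', Real.rpow_one]
  have hcoeff : ∀ j, (θ₀ / ε) ^ (-(B / C)) * (Qbar / Q j) = θ₀ / Q j := fun j => by
    have := (hQ j).ne'
    rw [hθpow]
    field_simp
  simp only [hcoeff] at hΦ
  set s : Fin M → ℝ := fun i => θ₀ / ε * Real.exp (a i - cc) with hs
  have hs0 : ∀ i, 0 < s i := fun i => by
    simp only [hs]
    positivity
  have ht0 : ∀ j, 0 < θ₀ / Q j := fun j => div_pos hθ₀0 (hQ j)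
  have hΦ1 : ∀ v i, ‖(Φ v).1 i‖ = s i * ‖v.1 i‖ := fun v i => by
    rw [hΦ, ← Real.norm_of_nonneg (hs0 i).le]
    exact norm_smul _ _
  have hΦ2 : ∀ v j, ‖(Φ v).2 j‖ = θ₀ / Q j * ‖v.2 j‖ := fun v j => by
    rw [hΦ]
    simp only [norm_smul, Real.norm_of_nonneg (ht0 j).le]
  -- `Φ` multiplies the multiplicative norm by a constant
  have hprods : ∏ i, s i ^ β i = (θ₀ / ε) ^ B * Real.exp (-(cc * B)) := by
    have h : ∀ i, s i ^ β i = (θ₀ / ε) ^ β i * Real.exp (β i * a i - cc * β i) := fun i => by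
      simp only [hs]
      rw [Real.mul_rpow (by positivity) (Real.exp_pos _).le, ← Real.exp_mul]
      ring_nf
    simp only [h, Finset.prod_mul_distrib]
    rw [← Real.rpow_sum_of_pos (by positivity), ← Real.exp_sum, Finset.sum_sub_distrib, ha,
      ← Finset.mul_sum, zero_sub]
  have hprodt : ∏ j, (θ₀ / Q j) ^ γ j = (θ₀ / Qbar) ^ C := by
    have h : ∀ j, (θ₀ / Q j) ^ γ j = θ₀ ^ γ j / Q j ^ γ j := fun j =>
      Real.div_rpow hθ₀0.le (hQ j).le _
    simp only [h, Finset.prod_div_distrib]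
    rw [← Real.rpow_sum_of_pos hθ₀0, ← hQbarC, Real.div_rpow hθ₀0.le hQbar0.le]
  have hprod : (∏ i, s i ^ β i) * ∏ j, (θ₀ / Q j) ^ γ j = Real.exp (-(cc * B)) := by
    rw [hprods, hprodt, Real.div_rpow hθ₀0.le hε.le, Real.div_rpow hθ₀0.le hQbar0.le]
    have h₁ : ε ^ B ≠ 0 := by positivity
    have h₂ : Qbar ^ C ≠ 0 := by positivity
    field_simp
    linear_combination hθ₀BC
  have hmult : ∀ v, Real.exp (-(cc * B)) ^ (1 / (B + C)) * multNorm β γ v ^ (1 / (B + C)) ≤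
      vNorm (Φ v) := fun v => by
    have h := multNorm_le_vNorm_rpow (Φ v) hβ hγ
    have h' : multNorm β γ (Φ v) = Real.exp (-(cc * B)) * multNorm β γ v := by
      rw [hΦ, multNorm_smul v β γ (fun i => (hs0 i).le) (fun j => (ht0 j).le), hprod]
    rw [h'] at h
    have hnn := multNorm_nonneg v β γ
    rw [← Real.mul_rpow (Real.exp_pos _).le hnn]
    refine (Real.rpow_le_rpow (mul_nonneg (Real.exp_pos _).le hnn) h (by positivity)).trans ?_
    rw [← Real.rpow_mul (vNorm_nonneg _), mul_one_div_cancel hBC.ne', Real.rpow_one]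
  have hzero_prod : ∀ p : (∀ i, EuclideanSpace ℝ (Fin (m i))) ×
      (∀ j, EuclideanSpace ℝ (Fin (n j))), (∃ i, p.1 i = 0) →
      (∏ i, ‖p.1 i‖ ^ β i) < ε ^ B := fun p ⟨i, hi⟩ => by
    rw [Finset.prod_eq_zero (Finset.mem_univ i)
      (by rw [hi, norm_zero, Real.zero_rpow (hβ i).ne'])]
    positivity
  have hZ0 : 0 ∈ Zset := by
    rw [hZ]
    exact ⟨⟨hzero_prod 0 ⟨⟨0, hM⟩, rfl⟩, fun i => by simpa using hT.le⟩,
      fun j => by simpa using (hQ j).le⟩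
  -- every coordinate direction of `Zset` is long compared with the scaling of `Φ` along it
  have hlong : ∀ i, ∃ t, 0 ≤ t ∧ k * θ₀ ≤ t * s i ∧ ∀ x : EuclideanSpace ℝ (Fin (m i)),
      ‖x‖ = t → ((Pi.single i x, 0) : (∀ i, EuclideanSpace ℝ (Fin (m i))) ×
        (∀ j, EuclideanSpace ℝ (Fin (n j)))) ∈ Zset := by
    intro i
    have hsi : κ * θ₀ ≤ T * s i := by
      calc κ * θ₀ = T * (θ₀ / ε * (κ * (ε / T))) := by field_simp
        _ ≤ T * s i := by
          simp only [hs]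
          gcongr
          exact haκ i
    have hle : ∀ x : EuclideanSpace ℝ (Fin (m i)), ‖x‖ ≤ T →
        ∀ i', ‖(Pi.single i x : ∀ i, EuclideanSpace ℝ (Fin (m i))) i'‖ ≤ T := by
      intro x hx i'
      by_cases hi : i' = i
      · subst hi
        simpa using hx
      · simpa [Pi.single_eq_of_ne hi] using hT.le
    by_cases hne : ∃ i', i' ≠ i
    · obtain ⟨i', hi'⟩ := hne
      refine ⟨T, hT.le, by nlinarith, fun x hx => ?_⟩
      rw [hZ]
      exact ⟨⟨hzero_prod _ ⟨i', Pi.single_eq_of_ne hi' _⟩, hle x hx.le⟩,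
        fun j => by simpa using (hQ j).le⟩
    · push Not at hne
      have huniv : (Finset.univ : Finset (Fin M)) = {i} := by
        ext i'
        simp [hne i']
      have hBi : B = β i := by rw [hBdef, huniv, Finset.sum_singleton]
      have hai : a i = 0 := by
        rw [huniv, Finset.sum_singleton] at ha
        exact (mul_eq_zero.1 ha).resolve_left (hβ i).ne'
      have hmem : ∀ t, 0 ≤ t → t ≤ T → t < ε → ∀ x : EuclideanSpace ℝ (Fin (m i)), ‖x‖ = t →
          ((Pi.single i x, 0) : (∀ i, EuclideanSpace ℝ (Fin (m i))) ×
            (∀ j, EuclideanSpace ℝ (Fin (n j)))) ∈ Zset := by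
        intro t ht htT htε x hx
        rw [hZ]
        refine ⟨⟨?_, hle x (hx.trans_le htT)⟩, fun j => by simpa using (hQ j).le⟩
        rw [huniv, Finset.prod_singleton, hBi]
        simp only [Pi.single_eq_same, hx]
        exact Real.rpow_lt_rpow ht htε (hβ i)
      rcases le_or_gt ε T with h | h
      · refine ⟨ε / 2, by positivity, ?_, hmem _ (by positivity) (by linarith) (by linarith)⟩
        have hval : ε / 2 * s i = θ₀ * Real.exp (-cc) / 2 := by
          simp only [hs, hai, zero_sub]
          field_simp
        rw [hval]
        nlinarith
      · refine ⟨T / 2, by positivity, by nlinarith,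
          hmem _ (by positivity) (by linarith) (by linarith)⟩
  have hexpand : ∀ (v : (∀ i, EuclideanSpace ℝ (Fin (m i))) × (∀ j, EuclideanSpace ℝ (Fin (n j))))
      (S : Set ((∀ i, EuclideanSpace ℝ (Fin (m i))) × (∀ j, EuclideanSpace ℝ (Fin (n j))))),
      (∀ p ∈ Zset, (∀ i, v.1 i = 0 → p.1 i = 0) → (∀ j, v.2 j = 0 → p.2 j = 0) → p ∈ S) →
      ENNReal.ofReal (k * θ₀ * vNorm v) / diamE S ≤ ENNReal.ofReal (vNorm (Φ v)) := by
    intro v S hS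
    have h0 : 0 ∈ S := hS 0 hZ0 (fun _ _ => rfl) (fun _ _ => rfl)
    refine ofReal_mul_div_diamE_le (by positivity) (fun i hi => ?_) (fun j hj => ?_)
    · obtain ⟨t, ht, hts, hmem⟩ := hlong i
      have hnorm : ‖(t / ‖v.1 i‖) • v.1 i‖ = t := by
        rw [norm_smul, norm_div, norm_norm, Real.norm_of_nonneg ht,
          div_mul_cancel₀ _ (norm_ne_zero_iff.2 hi)]
      refine ⟨t, ofReal_le_diamE h0 (hS _ (hmem _ hnorm) (fun i' hi' => ?_) fun _ _ => rfl)
        ?_, ?_⟩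
      · exact Pi.single_eq_of_ne (by rintro rfl; exact hi hi') _
      · refine le_of_eq_of_le ?_ (norm_fst_le_vNorm _ i)
        simp only [Pi.single_eq_same, hnorm]
      · rw [hΦ1, ← mul_assoc]
        gcongr
    · have hnorm : ‖(Q j / ‖v.2 j‖) • v.2 j‖ = Q j := by
        rw [norm_smul, norm_div, norm_norm, Real.norm_of_nonneg (hQ j).le,
          div_mul_cancel₀ _ (norm_ne_zero_iff.2 hj)]
      have hmem : ((0, Pi.single j ((Q j / ‖v.2 j‖) • v.2 j)) :
          (∀ i, EuclideanSpace ℝ (Fin (m i))) × (∀ j, EuclideanSpace ℝ (Fin (n j)))) ∈ Zset := by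
        rw [hZ]
        refine ⟨⟨hzero_prod _ ⟨⟨0, hM⟩, rfl⟩, fun i => by simpa using hT.le⟩, fun j' => ?_⟩
        by_cases h : j' = j
        · subst h
          simp only [Pi.single_eq_same]
          exact hnorm.le
        · simpa [Pi.single_eq_of_ne h] using (hQ j').le
      refine ⟨Q j, ofReal_le_diamE h0 (hS _ hmem (fun _ _ => rfl) (fun j' hj' => ?_)) ?_, ?_⟩
      · exact Pi.single_eq_of_ne (by rintro rfl; exact hj hj') _
      · refine le_of_eq_of_le ?_ (norm_snd_le_vNorm _ j)
        simp only [Pi.single_eq_same, hnorm]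
      · rw [hΦ2, ← mul_assoc, mul_div_cancel₀ _ (hQ j).ne']
        gcongr
        nlinarith
  rw [lambdaOne]
  refine le_iInf₂ fun w hw => le_iInf fun hw0 => ?_
  obtain ⟨v, hvΛ, rfl⟩ := hw
  have hv0 : v ≠ 0 := by
    rintro rfl
    apply hw0
    rw [hΦ]
    ext <;> simp
  by_cases hvC : v ∈ Cset
  · calc _ ≤ ENNReal.ofReal k * (ENNReal.ofReal θ₀ * ENNReal.ofReal (vNorm v) /
          diamE (Zset ∩ Cset)) := by
          refine mul_le_mul' (ENNReal.ofReal_le_ofReal (min_le_right _ _))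
            ((min_le_right _ _).trans ((min_le_right _ _).trans ?_))
          gcongr
          exact iInf₂_le_of_le v ⟨hvΛ, hvC⟩ (iInf_le _ hv0)
      _ = ENNReal.ofReal (k * θ₀ * vNorm v) / diamE (Zset ∩ Cset) := by
          rw [← mul_div_assoc, ← mul_assoc, ← ENNReal.ofReal_mul hk.le,
            ← ENNReal.ofReal_mul (by positivity)]
      _ ≤ _ := hexpand v _ fun p hp h₁ h₂ => ⟨hp, by
          rw [hCset] at hvC ⊢
          exact ⟨fun i hi => h₁ i (hvC.1 i hi), fun j hj => h₂ j (hvC.2 j hj)⟩⟩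
  rcases lt_or_ge (vNorm v) r with hvr | hvr
  · calc _ ≤ ENNReal.ofReal (Real.exp (-(cc * B)) ^ (1 / (B + C))) *
          ENNReal.ofReal (multNorm β γ v ^ (1 / (B + C))) := by
          refine mul_le_mul' (ENNReal.ofReal_le_ofReal (min_le_left _ _))
            ((min_le_left _ _).trans ?_)
          exact iInf₂_le_of_le v hvΛ (iInf₂_le_of_le hvC hvr le_rfl)
      _ ≤ _ := by
          rw [← ENNReal.ofReal_mul (by positivity)]
          exact ENNReal.ofReal_le_ofReal (hmult v)
  · calc _ ≤ ENNReal.ofReal k * (ENNReal.ofReal (θ₀ * vNorm v) / diamE Zset) := by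
          refine mul_le_mul' (ENNReal.ofReal_le_ofReal (min_le_right _ _))
            ((min_le_right _ _).trans ((min_le_left _ _).trans ?_))
          gcongr
      _ = ENNReal.ofReal (k * θ₀ * vNorm v) / diamE Zset := by
          rw [← mul_div_assoc, ← ENNReal.ofReal_mul hk.le, mul_assoc]
      _ ≤ _ := hexpand v _ fun p hp _ _ => hp
end
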